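/- arXiv:1303.6985 — 2 statements merged into one kernel-verified Lean document; each statement's English description precedes it below -/
import Mathlib

section
/- Let α, β, k₀, k₁, k₂, k₃ be nonnegative integers with k₀ ≤ α and k₁ + k₂ + k₃ ≤ β. Then the number of additive subgroups C of (ZMod 2)^α × (ZMod 8)^β such that (i) C is isomorphic as an abelian group to (ZMod 2)^{k₀+k₃} × (ZMod 8)^{k₁} × (ZMod 4)^{k₂}, and (ii) the image under the projection onto the first factor (ZMod 2)^α of the 2-torsion subgroup {c ∈ C : c + c = 0} is an F₂-subspace of (ZMod 2)^α of dimension k₀, is equal to N(α,β;k₀,k₁,k₂,k₃). -/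
open Finset

/-- The Mixed Generalized Gaussian Number `N(α,β;k₀,k₁,k₂,k₃)`. -/
def MGN (a b k₀ k₁ k₂ k₃ : ℕ) : ℚ :=
  ((∏ i ∈ range k₀, ((2 ^ a - 2 ^ i : ℚ) * 2 ^ b)) *
   (∏ i ∈ range k₁, ((8 ^ b - 4 ^ b * 2 ^ i : ℚ) * 2 ^ a)) *
   (∏ i ∈ range k₂, ((4 ^ b - 2 ^ (b + k₁ + i) : ℚ) * 2 ^ a)) *
   (∏ i ∈ range k₃, (2 ^ b - 2 ^ (k₁ + k₂ + i) : ℚ))) /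
  ((∏ i ∈ range k₀, (2 ^ (k₀ + k₁ + k₂ + k₃) - 2 ^ (k₁ + k₂ + k₃ + i) : ℚ)) *
   (∏ i ∈ range k₁, ((8 ^ k₁ - 4 ^ k₁ * 2 ^ i : ℚ) * 2 ^ (k₀ + 2 * k₂ + k₃))) *
   (∏ i ∈ range k₂, ((4 ^ k₂ - 2 ^ (k₂ + i) : ℚ) * 2 ^ (k₀ + 2 * k₁ + k₃))) *
   (∏ i ∈ range k₃, (2 ^ (k₁ + k₂ + k₃) - 2 ^ (k₁ + k₂ + i) : ℚ)))

theorem card_subtype_prod_of_card_fiber {X Y : Type*} [Finite X] [Finite Y]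
    {R : X → Y → Prop} {P : X → Prop} (hRP : ∀ x y, R x y → P x) (m : ℚ)
    (hm : ∀ x, P x → (Nat.card {y // R x y} : ℚ) = m) :
    (Nat.card {z : X × Y // R z.1 z.2} : ℚ) = Nat.card {x // P x} * m := by
  let e : {z : X × Y // R z.1 z.2} ≃ Σ x : {x // P x}, {y // R x.1 y} :=
    { toFun := fun z => ⟨⟨z.1.1, hRP _ _ z.2⟩, ⟨z.1.2, z.2⟩⟩
      invFun := fun z => ⟨(z.1.1, z.2.1), z.2.2⟩
      left_inv := fun _ => rfl
      right_inv := fun _ => rfl }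
  have := Fintype.ofFinite {x // P x}
  rw [Nat.card_congr e, Nat.card_sigma, Nat.cast_sum, Finset.sum_congr rfl fun x _ => hm x.1 x.2]
  simp [Nat.card_eq_fintype_card]

theorem AddMonoidHom.natCard_eq_ker_mul_range {A W : Type*} [AddCommGroup A] [AddCommGroup W]
    (ψ : A →+ W) : Nat.card A = Nat.card ψ.ker * Nat.card ψ.range := by
  rw [← AddSubgroup.index_ker, AddSubgroup.card_mul_index]

theorem card_linearIndependent_zmod_two (R : Type*) [AddCommGroup R] [Module (ZMod 2) R] [Finite R]
    (n : ℕ) :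
    (Nat.card {g : Fin n → R // LinearIndependent (ZMod 2) g} : ℚ)
      = ∏ i ∈ range n, ((Nat.card R : ℚ) - 2 ^ i) := by
  have : Fintype R := Fintype.ofFinite R
  have hR : Nat.card R = 2 ^ Module.finrank (ZMod 2) R := by
    rw [Module.natCard_eq_pow_finrank (K := ZMod 2)]; simp
  rw [hR]
  rcases le_or_gt n (Module.finrank (ZMod 2) R) with h | h
  · rw [card_linearIndependent (K := ZMod 2) h, Finset.prod_range]
    push_cast
    refine Finset.prod_congr rfl fun i _ => ?_
    rw [Nat.cast_sub (Nat.pow_le_pow_right (by simp) (by omega))]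
    simp
  · have : IsEmpty {g : Fin n → R // LinearIndependent (ZMod 2) g} :=
      ⟨fun g => by have := g.2.fintype_card_le_finrank; simp at this; omega⟩
    rw [Nat.card_of_isEmpty, Finset.prod_eq_zero (Finset.mem_range.2 h)] <;> simp

theorem card_linearIndependent_comp {A W : Type*} [AddCommGroup A] [Finite A] [AddCommGroup W]
    [Module (ZMod 2) W] (ψ : A →+ W) (n : ℕ) :
    (Nat.card {f : Fin n → A // LinearIndependent (ZMod 2) (ψ ∘ f)} : ℚ)
      = ∏ i ∈ range n, ((Nat.card A : ℚ) - Nat.card ψ.ker * 2 ^ i) := by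
  let R : Submodule (ZMod 2) W := AddSubgroup.toZModSubmodule 2 ψ.range
  have hs : ∀ r : R, ∃ a, ψ a = r := fun r => r.2
  choose s hs using hs
  have : Finite R := Set.finite_range ψ
  let r : A → R := fun a => ⟨ψ a, a, rfl⟩
  let e : A ≃ R × ψ.ker :=
    { toFun := fun a => (r a, ⟨a - s (r a), by simp [AddMonoidHom.mem_ker, hs, r]⟩)
      invFun := fun x => s x.1 + x.2
      left_inv := fun a => by simp
      right_inv := fun x => by
        have h : r (s x.1 + x.2) = x.1 := Subtype.ext <| by
          have := x.2.2
          rw [AddMonoidHom.mem_ker] at this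
          simp [r, hs, this]
        ext <;> simp [h] }
  have hLI : ∀ g : Fin n → R, LinearIndependent (ZMod 2) (fun i => (g i : W)) ↔
      LinearIndependent (ZMod 2) g := fun g =>
    LinearMap.linearIndependent_iff R.subtype (Submodule.ker_subtype R)
  let E : {f : Fin n → A // LinearIndependent (ZMod 2) (ψ ∘ f)} ≃
      {g : Fin n → R // LinearIndependent (ZMod 2) g} × (Fin n → ψ.ker) :=
    { toFun := fun f => (⟨fun i => (e (f.1 i)).1, (hLI _).1 f.2⟩, fun i => (e (f.1 i)).2)
      invFun := fun x => ⟨fun i => e.symm (x.1.1 i, x.2 i), by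
        have h : ψ ∘ (fun i => e.symm (x.1.1 i, x.2 i)) = fun i => (x.1.1 i : W) := by
          funext i
          exact congrArg (fun y : R × ψ.ker => (y.1 : W)) (e.apply_symm_apply (x.1.1 i, x.2 i))
        rw [h]
        exact (hLI _).2 x.1.2⟩
      left_inv := fun f => Subtype.ext (funext fun i => e.symm_apply_apply (f.1 i))
      right_inv := fun x => by
        have h := fun i => e.apply_symm_apply (x.1.1 i, x.2 i)
        refine Prod.ext (Subtype.ext (funext fun i => ?_)) (funext fun i => ?_)
        · exact congrArg Prod.fst (h i)
        · exact congrArg Prod.snd (h i) }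
  rw [Nat.card_congr E, Nat.card_prod, Nat.cast_mul, card_linearIndependent_zmod_two, Nat.card_fun,
    ψ.natCard_eq_ker_mul_range]
  have : Nat.card R = Nat.card ψ.range := rfl
  rw [this, Nat.card_eq_fintype_card (α := Fin n), Fintype.card_fin, Nat.cast_pow]
  conv_lhs => rw [← Finset.card_range n, ← Finset.prod_const, Finset.card_range,
    ← Finset.prod_mul_distrib]
  refine Finset.prod_congr rfl fun i _ => ?_
  push_cast
  ring

theorem card_linearIndependent_of_mem {A W : Type*} [AddCommGroup A] [Finite A] [AddCommGroup W]
    [Module (ZMod 2) W] (B : AddSubgroup A) (φ : A →+ W) (n : ℕ) :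
    (Nat.card {f : Fin n → A // (∀ i, f i ∈ B) ∧ LinearIndependent (ZMod 2) (φ ∘ f)} : ℚ)
      = ∏ i ∈ range n, ((Nat.card B : ℚ) - Nat.card {x : A // x ∈ B ∧ φ x = 0} * 2 ^ i) := by
  let ψ : B →+ W := φ.comp B.subtype
  let e : {f : Fin n → A // (∀ i, f i ∈ B) ∧ LinearIndependent (ZMod 2) (φ ∘ f)} ≃
      {g : Fin n → B // LinearIndependent (ZMod 2) (ψ ∘ g)} :=
    { toFun := fun f => ⟨fun i => ⟨f.1 i, f.2.1 i⟩, f.2.2⟩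
      invFun := fun g => ⟨fun i => g.1 i, fun i => (g.1 i).2, g.2⟩
      left_inv := fun _ => rfl
      right_inv := fun _ => rfl }
  let e' : ψ.ker ≃ {x : A // x ∈ B ∧ φ x = 0} :=
    { toFun := fun x => ⟨x.1.1, x.1.2, x.2⟩
      invFun := fun x => ⟨⟨x.1, x.2.1⟩, x.2.2⟩
      left_inv := fun _ => rfl
      right_inv := fun _ => rfl }
  rw [Nat.card_congr e, card_linearIndependent_comp, Nat.card_congr e']

theorem linearIndependent_sumElim_iff_mkQ {K W ι κ : Type*} [Field K] [AddCommGroup W] [Module K W]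
    {u : ι → W} (hu : LinearIndependent K u) (v : κ → W) :
    LinearIndependent K (Sum.elim u v) ↔
      LinearIndependent K ((Submodule.span K (Set.range u)).mkQ ∘ v) := by
  constructor
  · intro h
    obtain ⟨-, h2, h3⟩ := linearIndependent_sum.1 h
    refine LinearIndependent.map h2 ?_
    rw [Submodule.ker_mkQ]
    exact h3.symm
  · intro h
    have hu' : LinearIndependent K
        (fun i => (⟨u i, Submodule.subset_span ⟨i, rfl⟩⟩ : Submodule.span K (Set.range u))) :=
      LinearIndependent.of_comp (Submodule.span K (Set.range u)).subtype hu
    exact hu'.sumElim_of_quotient v h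

theorem card_extend_linearIndependent {A W ι : Type*} [AddCommGroup A] [Finite A] [AddCommGroup W]
    [Module (ZMod 2) W] [Fintype ι] (B : AddSubgroup A) (φ : A →+ W) {u : ι → W}
    (hu : LinearIndependent (ZMod 2) u) (huB : ∀ i, ∃ b ∈ B, φ b = u i) (n : ℕ) :
    (Nat.card {f : Fin n → A // (∀ i, f i ∈ B) ∧
        LinearIndependent (ZMod 2) (Sum.elim u (φ ∘ f))} : ℚ)
      = ∏ i ∈ range n, ((Nat.card B : ℚ) -
          Nat.card {x : A // x ∈ B ∧ φ x = 0} * 2 ^ (Fintype.card ι + i)) := by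
  set U := Submodule.span (ZMod 2) (Set.range u) with hU
  let ψ : B →+ W ⧸ U := (U.mkQ.toAddMonoidHom.comp φ).comp B.subtype
  let e : {f : Fin n → A // (∀ i, f i ∈ B) ∧ LinearIndependent (ZMod 2) (Sum.elim u (φ ∘ f))} ≃
      {g : Fin n → B // LinearIndependent (ZMod 2) (ψ ∘ g)} :=
    { toFun := fun f => ⟨fun i => ⟨f.1 i, f.2.1 i⟩,
        (linearIndependent_sumElim_iff_mkQ hu _).1 f.2.2⟩
      invFun := fun g => ⟨fun i => g.1 i, fun i => (g.1 i).2,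
        (linearIndependent_sumElim_iff_mkQ hu _).2 g.2⟩
      left_inv := fun _ => rfl
      right_inv := fun _ => rfl }
  have hker : Nat.card ψ.ker =
      Nat.card {x : A // x ∈ B ∧ φ x = 0} * 2 ^ Fintype.card ι := by
    let χ : ψ.ker →+ W := (φ.comp B.subtype).comp ψ.ker.subtype
    have hmem : ∀ b : B, b ∈ ψ.ker ↔ φ b ∈ U := fun b => by
      rw [AddMonoidHom.mem_ker]
      exact Submodule.Quotient.mk_eq_zero U
    rw [χ.natCard_eq_ker_mul_range]
    congr 1
    · refine Nat.card_congr
        { toFun := fun x => ⟨x.1.1.1, x.1.1.2, x.2⟩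
          invFun := fun x => ⟨⟨⟨x.1, x.2.1⟩, (hmem _).2 (by
            rw [x.2.2]; exact U.zero_mem)⟩, x.2.2⟩
          left_inv := fun _ => rfl
          right_inv := fun _ => rfl }
    · have hr : χ.range = U.toAddSubgroup := by
        apply le_antisymm
        · rintro _ ⟨x, rfl⟩
          exact (hmem x.1).1 x.2
        · have : U ≤ AddSubgroup.toZModSubmodule 2 (B.map φ) := by
            rw [hU, Submodule.span_le]
            rintro _ ⟨i, rfl⟩
            exact huB i
          intro w hw
          obtain ⟨b, hb, rfl⟩ := this hw
          exact ⟨⟨⟨b, hb⟩, (hmem _).2 hw⟩, rfl⟩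
      rw [hr]
      have : Module.Finite (ZMod 2) U :=
        FiniteDimensional.span_of_finite _ (Set.finite_range u)
      have : Nat.card U = 2 ^ Fintype.card ι := by
        rw [Module.natCard_eq_pow_finrank (K := ZMod 2), finrank_span_eq_card hu]
        simp
      exact this
  rw [Nat.card_congr e, card_linearIndependent_comp]
  refine Finset.prod_congr rfl fun i _ => ?_
  rw [hker]
  push_cast
  ring

/-- The subgroup of elements killed by `n`. -/
def nTorsion (G : Type*) [AddCommGroup G] (n : ℕ) : AddSubgroup G :=
  (nsmulAddMonoidHom n : G →+ G).ker

section Torsion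

variable {G : Type*} [AddCommGroup G]

theorem mem_nTorsion {n : ℕ} {x : G} : x ∈ nTorsion G n ↔ n • x = 0 := Iff.rfl

noncomputable instance nTorsion.zmodModule (n : ℕ) : Module (ZMod n) (nTorsion G n) :=
  AddCommGroup.zmodModule fun x => Subtype.ext x.2

/-- Multiplication by `m`, from the `2m`-torsion to the `2`-torsion. -/
def nsmulTorsion (m : ℕ) {n : ℕ} (h : 2 * m = n) : nTorsion G n →+ nTorsion G 2 where
  toFun x := ⟨m • (x : G), by
    have := x.2
    rw [mem_nTorsion] at this ⊢
    rw [← mul_smul, h, this]⟩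
  map_zero' := by simp
  map_add' x y := by ext; simp

@[simp]
theorem coe_nsmulTorsion (m : ℕ) {n : ℕ} (h : 2 * m = n) (x : nTorsion G n) :
    (nsmulTorsion m h x : G) = m • (x : G) := rfl

/-- The coefficient in `ZMod 2` of a multiple of `m` in `ZMod (2 * m)`. -/
def halfCoeff {n : ℕ} (m : ℕ) (x : ZMod n) : ZMod 2 := if x = (m : ZMod n) then 1 else 0

theorem halfCoeff_eq_zero {n m : ℕ} (hn : ∀ x : ZMod n, x + x = 0 → x = 0 ∨ x = (m : ZMod n))
    {x : ZMod n} (hx : x + x = 0) (h : halfCoeff m x = 0) : x = 0 := by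
  rcases hn x hx with h' | h'
  · exact h'
  · simp [halfCoeff, h'] at h

theorem coe_smul_of_add_self_eq_zero {n m : ℕ} (h : 2 * m = n) (hm : (m : ZMod n) ≠ 0)
    (hn : ∀ x : ZMod n, x + x = 0 → x = 0 ∨ x = (m : ZMod n)) {x : ZMod n} (hx : x + x = 0)
    (g : nTorsion G n) :
    ((x • g : nTorsion G n) : G) = (halfCoeff m x • nsmulTorsion m h g : nTorsion G 2) := by
  rcases hn x hx with rfl | rfl
  · simp [halfCoeff, hm.symm]
  · simp [halfCoeff, Nat.cast_smul_eq_nsmul]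

theorem ZMod.eq_zero_or_four : ∀ x : ZMod 8, x + x = 0 → x = 0 ∨ x = (4 : ℕ) := by decide

theorem ZMod.eq_zero_or_two : ∀ x : ZMod 4, x + x = 0 → x = 0 ∨ x = (2 : ℕ) := by decide

theorem card_addSubgroupOf_nTorsion (C : AddSubgroup G) (n : ℕ) :
    Nat.card (C.addSubgroupOf (nTorsion G n)) = Nat.card {x : G // x ∈ C ∧ n • x = 0} :=
  Nat.card_congr
    { toFun := fun x => ⟨x.1.1, x.2, x.1.2⟩
      invFun := fun x => ⟨⟨x.1, x.2.2⟩, x.2.1⟩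
      left_inv := fun _ => rfl
      right_inv := fun _ => rfl }

theorem card_nsmulTorsion_eq_zero (C : AddSubgroup G) (m : ℕ) {n : ℕ} (h : 2 * m = n) :
    Nat.card {x : nTorsion G n // x ∈ C.addSubgroupOf (nTorsion G n) ∧ nsmulTorsion m h x = 0} =
      Nat.card {x : G // x ∈ C ∧ m • x = 0} :=
  Nat.card_congr
    { toFun := fun x => ⟨x.1.1, x.2.1, congrArg Subtype.val x.2.2⟩
      invFun := fun x => ⟨⟨x.1, by rw [mem_nTorsion, ← h, mul_smul, x.2.2, smul_zero]⟩,
        x.2.1, Subtype.ext x.2.2⟩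
      left_inv := fun _ => rfl
      right_inv := fun _ => rfl }

variable {V : Type*} [AddCommGroup V] [Module (ZMod 2) V] {k₀ k₁ k₂ k₃ : ℕ}

/-- The restriction of `π` to the `2`-torsion. -/
noncomputable def torsionProj (π : G →+ V) : nTorsion G 2 →ₗ[ZMod 2] V :=
  (π.comp (nTorsion G 2).subtype).toZModLinearMap 2

@[simp]
theorem torsionProj_apply (π : G →+ V) (x : nTorsion G 2) : torsionProj π x = π x := rfl

variable (G k₀ k₁ k₂ k₃) in
/-- Candidate generating tuples: `k₀` elements of order two, `k₁` of order eight, `k₂` of order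
four and `k₃` further elements of order two. -/
abbrev GenTuple : Type _ :=
  (Fin k₀ → nTorsion G 2) ×
    ((Fin k₁ → nTorsion G 8) × (Fin k₂ → nTorsion G 4)) × (Fin k₃ → nTorsion G 2)

/-- The multiples of order two of the generators of orders eight and four. -/
def socleFamily (b : Fin k₁ → nTorsion G 8) (c : Fin k₂ → nTorsion G 4) :
    Fin k₁ ⊕ Fin k₂ → nTorsion G 2 :=
  Sum.elim (nsmulTorsion 4 rfl ∘ b) (nsmulTorsion 2 rfl ∘ c)

/-- The order eight and order four part of a frame. -/
def IsUpperFrame (C : AddSubgroup G) (b : Fin k₁ → nTorsion G 8) (c : Fin k₂ → nTorsion G 4) :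
    Prop :=
  ((∀ i, b i ∈ C.addSubgroupOf _) ∧
    LinearIndependent (ZMod 2) (nsmulTorsion (G := G) 4 rfl ∘ b)) ∧
  ((∀ i, c i ∈ C.addSubgroupOf _) ∧ LinearIndependent (ZMod 2) (socleFamily b c))

/-- The part of a frame that is independent modulo the kernel of `π`. -/
def IsOuterFrame (π : G →+ V) (C : AddSubgroup G) (a : Fin k₀ → nTorsion G 2) : Prop :=
  (∀ i, a i ∈ C.addSubgroupOf _) ∧ LinearIndependent (ZMod 2) (torsionProj π ∘ a)

/-- The part of a frame generated inside the second factor. -/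
def IsInnerFrame (π : G →+ V) (C : AddSubgroup G)
    (F : ((Fin k₁ → nTorsion G 8) × (Fin k₂ → nTorsion G 4)) × (Fin k₃ → nTorsion G 2)) : Prop :=
  IsUpperFrame C F.1.1 F.1.2 ∧
    ((∀ i, F.2 i ∈ C.addSubgroupOf _ ⊓ (torsionProj π).toAddMonoidHom.ker) ∧
      LinearIndependent (ZMod 2) (Sum.elim (socleFamily F.1.1 F.1.2) F.2))

/-- A tuple of elements of `C` that is a standard generating system of the code it spans. -/
def IsFrame (π : G →+ V) (C : AddSubgroup G) (F : GenTuple G k₀ k₁ k₂ k₃) : Prop :=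
  IsOuterFrame π C F.1 ∧ IsInnerFrame π C F.2

theorem map_two_nsmul_eq_zero (π : G →+ V) (x : G) : π (2 • x) = 0 := by
  rw [map_nsmul]
  exact ZModModule.char_nsmul_eq_zero 2 (π x)

theorem card_isOuterFrame [Finite G] (π : G →+ V) (C : AddSubgroup G) :
    (Nat.card {a : Fin k₀ → nTorsion G 2 // IsOuterFrame π C a} : ℚ) =
      ∏ i ∈ range k₀, ((Nat.card {x : G // x ∈ C ∧ 2 • x = 0} : ℚ) -
        Nat.card {x : G // x ∈ C ∧ 2 • x = 0 ∧ π x = 0} * 2 ^ i) := by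
  have := card_linearIndependent_of_mem (C.addSubgroupOf (nTorsion G 2))
    (torsionProj π).toAddMonoidHom k₀
  rw [card_addSubgroupOf_nTorsion] at this
  let e : {x : nTorsion G 2 // x ∈ C.addSubgroupOf (nTorsion G 2) ∧
      (torsionProj π).toAddMonoidHom x = 0} ≃ {x : G // x ∈ C ∧ 2 • x = 0 ∧ π x = 0} :=
    { toFun := fun x => ⟨x.1.1, x.2.1, x.1.2, x.2.2⟩
      invFun := fun x => ⟨⟨x.1, x.2.2.1⟩, x.2.1, x.2.2.2⟩
      left_inv := fun _ => rfl
      right_inv := fun _ => rfl }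
  rw [Nat.card_congr e] at this
  exact this

theorem card_isUpperFrame [Finite G] (C : AddSubgroup G) :
    (Nat.card {F : (Fin k₁ → nTorsion G 8) × (Fin k₂ → nTorsion G 4) //
        IsUpperFrame C F.1 F.2} : ℚ) =
      (∏ i ∈ range k₁, ((Nat.card {x : G // x ∈ C ∧ 8 • x = 0} : ℚ) -
        Nat.card {x : G // x ∈ C ∧ 4 • x = 0} * 2 ^ i)) *
      ∏ i ∈ range k₂, ((Nat.card {x : G // x ∈ C ∧ 4 • x = 0} : ℚ) -
        Nat.card {x : G // x ∈ C ∧ 2 • x = 0} * 2 ^ (k₁ + i)) := by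
  have h8 := card_linearIndependent_of_mem (C.addSubgroupOf (nTorsion G 8))
    (nsmulTorsion 4 rfl) k₁
  rw [card_addSubgroupOf_nTorsion, card_nsmulTorsion_eq_zero] at h8
  rw [← h8]
  refine card_subtype_prod_of_card_fiber (fun _ _ h => h.1) _ fun b hb => ?_
  have hmem : ∀ i, 2 • (b i : G) ∈ nTorsion G 4 := fun i => by
    rw [mem_nTorsion, ← mul_smul]
    exact (b i).2
  have h4 := card_extend_linearIndependent (C.addSubgroupOf (nTorsion G 4))
    (nsmulTorsion 2 rfl) hb.2 (fun i => ⟨⟨2 • (b i : G), hmem i⟩,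
      AddSubgroup.mem_addSubgroupOf.2 (C.nsmul_mem (hb.1 i) 2),
      Subtype.ext (mul_smul 2 2 (b i : G)).symm⟩) k₂
  rw [card_addSubgroupOf_nTorsion, card_nsmulTorsion_eq_zero, Fintype.card_fin] at h4
  rw [← h4]
  refine congrArg _ (Nat.card_congr (Equiv.subtypeEquivRight fun c => ?_))
  exact and_iff_right hb

theorem card_isInnerFrame [Finite G] (π : G →+ V) (C : AddSubgroup G) :
    (Nat.card {F : ((Fin k₁ → nTorsion G 8) × (Fin k₂ → nTorsion G 4)) × (Fin k₃ → nTorsion G 2) //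
        IsInnerFrame π C F} : ℚ) =
      (Nat.card {F : (Fin k₁ → nTorsion G 8) × (Fin k₂ → nTorsion G 4) //
        IsUpperFrame C F.1 F.2} : ℚ) *
      ∏ i ∈ range k₃, ((Nat.card {x : G // x ∈ C ∧ 2 • x = 0 ∧ π x = 0} : ℚ) -
        2 ^ (k₁ + k₂ + i)) := by
  refine card_subtype_prod_of_card_fiber (R := fun F d => IsInnerFrame π C (F, d))
    (fun _ _ h => h.1) _ fun F hF => ?_
  have h2 := card_extend_linearIndependent
    (C.addSubgroupOf (nTorsion G 2) ⊓ (torsionProj π).toAddMonoidHom.ker)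
    (AddMonoidHom.id _) hF.2.2 (fun i => ⟨_, ?_, rfl⟩) k₃
  · let e : ↥(C.addSubgroupOf (nTorsion G 2) ⊓ (torsionProj π).toAddMonoidHom.ker) ≃
        {x : G // x ∈ C ∧ 2 • x = 0 ∧ π x = 0} :=
      { toFun := fun x => ⟨x.1.1, x.2.1, x.1.2, x.2.2⟩
        invFun := fun x => ⟨⟨x.1, x.2.2.1⟩, x.2.1, x.2.2.2⟩
        left_inv := fun _ => rfl
        right_inv := fun _ => rfl }
    have h1 : Nat.card {x : nTorsion G 2 // x ∈ C.addSubgroupOf (nTorsion G 2) ⊓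
        (torsionProj π).toAddMonoidHom.ker ∧ AddMonoidHom.id _ x = 0} = 1 := by
      rw [Nat.card_eq_one_iff_unique]
      exact ⟨⟨fun x y => Subtype.ext (x.2.2.trans y.2.2.symm)⟩,
        ⟨⟨0, AddSubgroup.zero_mem _, rfl⟩⟩⟩
    rw [h1, Nat.card_congr e, Fintype.card_sum, Fintype.card_fin, Fintype.card_fin] at h2
    simp only [Nat.cast_one, one_mul] at h2
    rw [← h2]
    refine congrArg _ (Nat.card_congr (Equiv.subtypeEquivRight fun c => ?_))
    exact and_iff_right hF
  · rcases i with i | i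
    · refine ⟨C.nsmul_mem (hF.1.1 i) 4, ?_⟩
      exact (congrArg π (mul_smul 2 2 (F.1 i : G))).trans (map_two_nsmul_eq_zero π _)
    · exact ⟨C.nsmul_mem (hF.2.1 i) 2, map_two_nsmul_eq_zero π _⟩

theorem card_isFrame [Finite G] (π : G →+ V) (C : AddSubgroup G) :
    (Nat.card {F : GenTuple G k₀ k₁ k₂ k₃ // IsFrame π C F} : ℚ) =
      (∏ i ∈ range k₀, ((Nat.card {x : G // x ∈ C ∧ 2 • x = 0} : ℚ) -
        Nat.card {x : G // x ∈ C ∧ 2 • x = 0 ∧ π x = 0} * 2 ^ i)) *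
      (∏ i ∈ range k₁, ((Nat.card {x : G // x ∈ C ∧ 8 • x = 0} : ℚ) -
        Nat.card {x : G // x ∈ C ∧ 4 • x = 0} * 2 ^ i)) *
      (∏ i ∈ range k₂, ((Nat.card {x : G // x ∈ C ∧ 4 • x = 0} : ℚ) -
        Nat.card {x : G // x ∈ C ∧ 2 • x = 0} * 2 ^ (k₁ + i))) *
      ∏ i ∈ range k₃, ((Nat.card {x : G // x ∈ C ∧ 2 • x = 0 ∧ π x = 0} : ℚ) -
        2 ^ (k₁ + k₂ + i)) := by
  rw [mul_assoc (∏ i ∈ range k₀, _), ← card_isUpperFrame, mul_assoc, ← card_isInnerFrame,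
    ← card_isOuterFrame, ← Nat.cast_mul, ← Nat.card_prod]
  exact congrArg _ (Nat.card_congr Equiv.subtypeProdEquivProd)

/-- The standard group of type `(2^m, 8^k₁, 4^k₂)`. -/
abbrev StdGroup (m k₁ k₂ : ℕ) : Type :=
  (Fin m → ZMod 2) × (Fin k₁ → ZMod 8) × (Fin k₂ → ZMod 4)

namespace GenTuple

/-- The homomorphism from the standard group sending the standard generators to the tuple. -/
noncomputable def hom (F : GenTuple G k₀ k₁ k₂ k₃) : StdGroup (k₀ + k₃) k₁ k₂ →+ G :=
  ((nTorsion G 2).subtype.comp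
    (Fintype.linearCombination (ZMod 2) (Fin.append F.1 F.2.2)).toAddMonoidHom).coprod
  (((nTorsion G 8).subtype.comp
    (Fintype.linearCombination (ZMod 8) F.2.1.1).toAddMonoidHom).coprod
  ((nTorsion G 4).subtype.comp
    (Fintype.linearCombination (ZMod 4) F.2.1.2).toAddMonoidHom))

theorem hom_apply (F : GenTuple G k₀ k₁ k₂ k₃) (s : StdGroup (k₀ + k₃) k₁ k₂) :
    F.hom s = (∑ i, s.1 i • Fin.append F.1 F.2.2 i : nTorsion G 2) +
      ((∑ i, s.2.1 i • F.2.1.1 i : nTorsion G 8) +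
        (∑ i, s.2.2 i • F.2.1.2 i : nTorsion G 4)) := rfl

/-- The coefficients of a `2`-torsion element on the part of the frame inside the second factor. -/
def innerCoeff (s : StdGroup (k₀ + k₃) k₁ k₂) : (Fin k₁ ⊕ Fin k₂) ⊕ Fin k₃ → ZMod 2 :=
  Sum.elim (Sum.elim (fun i => halfCoeff 4 (s.2.1 i)) (fun i => halfCoeff 2 (s.2.2 i)))
    (fun i => s.1 (Fin.natAdd k₀ i))

theorem hom_of_add_self_eq_zero (F : GenTuple G k₀ k₁ k₂ k₃) {s : StdGroup (k₀ + k₃) k₁ k₂}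
    (hs : s + s = 0) :
    F.hom s = (∑ i, s.1 (Fin.castAdd k₃ i) • F.1 i + ∑ j, innerCoeff s j •
      Sum.elim (socleFamily F.2.1.1 F.2.1.2) F.2.2 j : nTorsion G 2) := by
  have h8 : ∀ i, s.2.1 i + s.2.1 i = 0 := fun i => congrFun (congrArg (fun t => t.2.1) hs) i
  have h4 : ∀ i, s.2.2 i + s.2.2 i = 0 := fun i => congrFun (congrArg (fun t => t.2.2) hs) i
  rw [hom_apply]
  simp only [AddSubgroup.coe_add, AddSubgroup.val_finsetSum, Fin.sum_univ_add, Fintype.sum_sum_type,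
    Fin.append_left, Fin.append_right, innerCoeff, socleFamily, Sum.elim_inl, Sum.elim_inr,
    Function.comp_apply,
    fun i => coe_smul_of_add_self_eq_zero (G := G) (m := 4) rfl (by decide) ZMod.eq_zero_or_four
      (h8 i),
    fun i => coe_smul_of_add_self_eq_zero (G := G) (m := 2) rfl (by decide) ZMod.eq_zero_or_two
      (h4 i)]
  abel

theorem hom_mem {C : AddSubgroup G} {π : G →+ V} {F : GenTuple G k₀ k₁ k₂ k₃}
    (hF : IsFrame π C F) (s : StdGroup (k₀ + k₃) k₁ k₂) : F.hom s ∈ C := by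
  have key : ∀ {n m : ℕ} (v : Fin m → nTorsion G n) (_ : ∀ i, v i ∈ C.addSubgroupOf (nTorsion G n))
      (y : Fin m → ZMod n), ((∑ i, y i • v i : nTorsion G n) : G) ∈ C := fun {n m} v hv y => by
    have h : ∑ i, y i • v i ∈ AddSubgroup.toZModSubmodule n (C.addSubgroupOf (nTorsion G n)) :=
      Submodule.sum_mem _ fun i _ => Submodule.smul_mem _ _ (hv i)
    exact h
  rw [hom_apply]
  refine C.add_mem (key _ (fun i => ?_) _) (C.add_mem (key _ hF.2.1.1.1 _) (key _ hF.2.1.2.1 _))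
  refine Fin.addCases (fun i => ?_) (fun i => ?_) i
  · rw [Fin.append_left]
    exact hF.1.1 i
  · rw [Fin.append_right]
    exact (hF.2.2.1 i).1

theorem fst_mem_range (F : GenTuple G k₀ k₁ k₂ k₃) (i : Fin k₀) : (F.1 i : G) ∈ F.hom.range :=
  ⟨(Pi.single (Fin.castAdd k₃ i) 1, 0, 0), by simp [hom_apply, Pi.single_apply, ite_smul]⟩

theorem eight_mem_range (F : GenTuple G k₀ k₁ k₂ k₃) (i : Fin k₁) :
    (F.2.1.1 i : G) ∈ F.hom.range :=
  ⟨(0, Pi.single i 1, 0), by simp [hom_apply, Pi.single_apply, ite_smul]⟩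

theorem four_mem_range (F : GenTuple G k₀ k₁ k₂ k₃) (i : Fin k₂) :
    (F.2.1.2 i : G) ∈ F.hom.range :=
  ⟨(0, 0, Pi.single i 1), by simp [hom_apply, Pi.single_apply, ite_smul]⟩

theorem inner_mem_range (F : GenTuple G k₀ k₁ k₂ k₃) (i : Fin k₃) : (F.2.2 i : G) ∈ F.hom.range :=
  ⟨(Pi.single (Fin.natAdd k₀ i) 1, 0, 0), by simp [hom_apply, Pi.single_apply, ite_smul]⟩

end GenTuple

theorem isFrame_iff {π : G →+ V} {C : AddSubgroup G} {F : GenTuple G k₀ k₁ k₂ k₃} :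
    IsFrame π C F ↔ IsFrame π ⊤ F ∧ F.hom.range ≤ C := by
  constructor
  · intro hF
    refine ⟨⟨⟨fun _ => trivial, hF.1.2⟩, ⟨⟨fun _ => trivial, hF.2.1.1.2⟩, fun _ => trivial,
      hF.2.1.2.2⟩, fun i => ⟨trivial, (hF.2.2.1 i).2⟩, hF.2.2.2⟩, ?_⟩
    rintro _ ⟨s, rfl⟩
    exact GenTuple.hom_mem hF s
  · rintro ⟨hF, h⟩
    exact ⟨⟨fun i => h (F.fst_mem_range i), hF.1.2⟩,
      ⟨⟨fun i => h (F.eight_mem_range i), hF.2.1.1.2⟩, fun i => h (F.four_mem_range i),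
        hF.2.1.2.2⟩, fun i => ⟨h (F.inner_mem_range i), (hF.2.2.1 i).2⟩, hF.2.2.2⟩

theorem IsFrame.map_hom {π : G →+ V} {F : GenTuple G k₀ k₁ k₂ k₃} (hF : IsFrame π ⊤ F)
    {s : StdGroup (k₀ + k₃) k₁ k₂} (hs : s + s = 0) :
    π (F.hom s) = ∑ i, s.1 (Fin.castAdd k₃ i) • π (F.1 i) := by
  rw [F.hom_of_add_self_eq_zero hs, ← torsionProj_apply, map_add, map_sum, map_sum]
  have h0 : ∀ j, torsionProj π (Sum.elim (socleFamily F.2.1.1 F.2.1.2) F.2.2 j) = 0 := by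
    rintro ((i | i) | i)
    · exact (congrArg π (mul_smul 2 2 (F.2.1.1 i : G))).trans (map_two_nsmul_eq_zero π _)
    · exact map_two_nsmul_eq_zero π _
    · exact (hF.2.2.1 i).2
  simp only [map_smul, h0, smul_zero, sum_const_zero, add_zero, torsionProj_apply]

theorem StdGroup.eight_nsmul {m : ℕ} (s : StdGroup m k₁ k₂) : 8 • s = 0 := by
  have h2 : ∀ x : ZMod 2, 8 • x = 0 := by decide
  have h4 : ∀ x : ZMod 4, 8 • x = 0 := by decide
  have h8 : ∀ x : ZMod 8, 8 • x = 0 := by decide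
  refine Prod.ext (funext fun i => h2 _) (Prod.ext (funext fun i => h8 _) (funext fun i => h4 _))

theorem IsFrame.hom_injective {π : G →+ V} {F : GenTuple G k₀ k₁ k₂ k₃} (hF : IsFrame π ⊤ F) :
    Function.Injective F.hom := by
  have key : ∀ s : StdGroup (k₀ + k₃) k₁ k₂, s + s = 0 → F.hom s = 0 → s = 0 := by
    intro s hs h
    have ha : ∀ i, s.1 (Fin.castAdd k₃ i) = 0 := by
      refine Fintype.linearIndependent_iff.1 hF.1.2 _ ?_
      have := hF.map_hom hs
      rw [h, map_zero] at this
      exact this.symm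
    have hinner : ∀ j, GenTuple.innerCoeff s j = 0 := by
      refine Fintype.linearIndependent_iff.1 hF.2.2.2 _ ?_
      have := F.hom_of_add_self_eq_zero hs
      simp only [ha, zero_smul, sum_const_zero, zero_add, h] at this
      exact Subtype.ext this.symm
    refine Prod.ext (funext fun i => Fin.addCases ha (fun i => hinner (Sum.inr i)) i)
      (Prod.ext (funext fun i => ?_) (funext fun i => ?_))
    · exact halfCoeff_eq_zero ZMod.eq_zero_or_four
        (congrFun (congrArg (fun t => t.2.1) hs) i) (hinner (Sum.inl (Sum.inl i)))
    · exact halfCoeff_eq_zero ZMod.eq_zero_or_two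
        (congrFun (congrArg (fun t => t.2.2) hs) i) (hinner (Sum.inl (Sum.inr i)))
  rw [injective_iff_map_eq_zero]
  intro s h
  have h4 : 4 • s = 0 := key _ (by rw [← add_smul]; exact s.eight_nsmul)
    (by rw [map_nsmul, h, nsmul_zero])
  have h2 : 2 • s = 0 := key _ (by rw [← add_smul]; exact h4) (by rw [map_nsmul, h, nsmul_zero])
  exact key s (by rw [← two_nsmul]; exact h2) h

variable (k₀ k₁ k₂ k₃) in
/-- `C` is a code of type `(k₀, k₁, k₂, k₃)`. -/
def HasCodeType (π : G →+ V) (C : AddSubgroup G) : Prop :=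
  Nonempty (C ≃+ StdGroup (k₀ + k₃) k₁ k₂) ∧
    ∃ W : Submodule (ZMod 2) V, Module.finrank (ZMod 2) W = k₀ ∧
      (W : Set V) = π '' {c : G | c ∈ C ∧ c + c = 0}

theorem IsFrame.hasCodeType_range {π : G →+ V} {F : GenTuple G k₀ k₁ k₂ k₃}
    (hF : IsFrame π ⊤ F) : HasCodeType k₀ k₁ k₂ k₃ π F.hom.range := by
  refine ⟨⟨(AddMonoidHom.ofInjective hF.hom_injective).symm⟩,
    Submodule.span (ZMod 2) (Set.range (torsionProj π ∘ F.1)), ?_, ?_⟩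
  · rw [finrank_span_eq_card hF.1.2, Fintype.card_fin]
  · ext v
    rw [SetLike.mem_coe, Submodule.mem_span_range_iff_exists_fun]
    constructor
    · rintro ⟨y, rfl⟩
      let s : StdGroup (k₀ + k₃) k₁ k₂ := (Fin.append y 0, 0, 0)
      have hs : s + s = 0 := Prod.ext (funext fun i => CharTwo.add_self_eq_zero _)
        (Prod.ext (add_zero _) (add_zero _))
      refine ⟨F.hom s, ⟨⟨s, rfl⟩, by rw [← map_add, hs, map_zero]⟩, ?_⟩
      rw [hF.map_hom hs]
      simp [s]
    · rintro ⟨_, ⟨⟨s, rfl⟩, hs⟩, rfl⟩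
      have hs' : s + s = 0 := hF.hom_injective (by rw [map_add, hs, map_zero])
      exact ⟨_, (hF.map_hom hs').symm⟩

theorem IsFrame.range_eq [Finite G] {π : G →+ V} {C : AddSubgroup G}
    {F : GenTuple G k₀ k₁ k₂ k₃} (hF : IsFrame π C F) (hC : HasCodeType k₀ k₁ k₂ k₃ π C) :
    F.hom.range = C := by
  obtain ⟨hF', h⟩ := isFrame_iff.1 hF
  obtain ⟨e⟩ := hC.1
  refine AddSubgroup.eq_of_le_of_card_ge h ?_
  rw [Nat.card_congr e.toEquiv,
    Nat.card_congr (AddMonoidHom.ofInjective hF'.hom_injective).toEquiv]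

theorem card_hasCodeType_mul [Finite G] (π : G →+ V) (D : ℚ)
    (hD : ∀ C, HasCodeType k₀ k₁ k₂ k₃ π C →
      (Nat.card {F : GenTuple G k₀ k₁ k₂ k₃ // IsFrame π C F} : ℚ) = D) :
    (Nat.card {C : AddSubgroup G // HasCodeType k₀ k₁ k₂ k₃ π C} : ℚ) * D =
      Nat.card {F : GenTuple G k₀ k₁ k₂ k₃ // IsFrame π ⊤ F} := by
  rw [← card_subtype_prod_of_card_fiber
    (R := fun C F => HasCodeType k₀ k₁ k₂ k₃ π C ∧ IsFrame π C F) (fun _ _ h => h.1) D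
    (fun C hC => by simpa only [hC, true_and] using hD C hC),
    ← mul_one (Nat.card {F : GenTuple G k₀ k₁ k₂ k₃ // IsFrame π ⊤ F} : ℚ),
    ← card_subtype_prod_of_card_fiber
    (R := fun F C => HasCodeType k₀ k₁ k₂ k₃ π C ∧ IsFrame π C F)
    (fun _ _ h => (isFrame_iff.1 h.2).1) 1]
  · exact congrArg _ (Nat.card_congr ((Equiv.prodComm _ _).subtypeEquiv fun _ => Iff.rfl))
  · intro F hF
    rw [Nat.cast_eq_one, Nat.card_eq_one_iff_unique]
    exact ⟨⟨fun C C' => Subtype.ext ((C.2.2.range_eq C.2.1).symm.trans (C'.2.2.range_eq C'.2.1))⟩,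
      ⟨⟨F.hom.range, hF.hasCodeType_range, isFrame_iff.2 ⟨hF, le_rfl⟩⟩⟩⟩

end Torsion

theorem card_nsmul_eq_zero_prod (X Y : Type*) [AddCommGroup X] [AddCommGroup Y] (n : ℕ) :
    Nat.card {x : X × Y // n • x = 0} = Nat.card {x : X // n • x = 0} *
      Nat.card {y : Y // n • y = 0} := by
  rw [← Nat.card_prod]
  exact Nat.card_congr (((Equiv.refl _).subtypeEquiv fun _ => Prod.ext_iff).trans
    (Equiv.subtypeProdEquivProd (p := fun x : X => n • x = 0) (q := fun y : Y => n • y = 0)))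

theorem card_nsmul_eq_zero_pi (k : ℕ) (X : Type*) [AddCommGroup X] [Finite X] (n : ℕ) :
    Nat.card {x : Fin k → X // n • x = 0} = Nat.card {x : X // n • x = 0} ^ k := by
  let e : {x : Fin k → X // n • x = 0} ≃ (Fin k → {x : X // n • x = 0}) :=
    { toFun := fun x i => ⟨x.1 i, congrFun x.2 i⟩
      invFun := fun y => ⟨fun i => y i, funext fun i => (y i).2⟩
      left_inv := fun _ => rfl
      right_inv := fun _ => rfl }
  rw [Nat.card_congr e, Nat.card_fun, Nat.card_eq_fintype_card (α := Fin k), Fintype.card_fin]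

theorem card_two_nsmul_zmod_two : Nat.card {x : ZMod 2 // 2 • x = 0} = 2 := by
  rw [Nat.card_eq_fintype_card]; rfl

theorem card_four_nsmul_zmod_two : Nat.card {x : ZMod 2 // 4 • x = 0} = 2 := by
  rw [Nat.card_eq_fintype_card]; rfl

theorem card_eight_nsmul_zmod_two : Nat.card {x : ZMod 2 // 8 • x = 0} = 2 := by
  rw [Nat.card_eq_fintype_card]; rfl

theorem card_two_nsmul_zmod_four : Nat.card {x : ZMod 4 // 2 • x = 0} = 2 := by
  rw [Nat.card_eq_fintype_card]; rfl

theorem card_four_nsmul_zmod_four : Nat.card {x : ZMod 4 // 4 • x = 0} = 4 := by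
  rw [Nat.card_eq_fintype_card]; rfl

theorem card_eight_nsmul_zmod_four : Nat.card {x : ZMod 4 // 8 • x = 0} = 4 := by
  rw [Nat.card_eq_fintype_card]; rfl

theorem card_two_nsmul_zmod_eight : Nat.card {x : ZMod 8 // 2 • x = 0} = 2 := by
  rw [Nat.card_eq_fintype_card]; rfl

theorem card_four_nsmul_zmod_eight : Nat.card {x : ZMod 8 // 4 • x = 0} = 4 := by
  rw [Nat.card_eq_fintype_card]; rfl

theorem card_eight_nsmul_zmod_eight : Nat.card {x : ZMod 8 // 8 • x = 0} = 8 := by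
  rw [Nat.card_eq_fintype_card]; rfl

section CodeType

variable {G V : Type*} [AddCommGroup G] [AddCommGroup V] [Module (ZMod 2) V] {k₀ k₁ k₂ k₃ : ℕ}

theorem HasCodeType.card_nsmul {π : G →+ V} {C : AddSubgroup G}
    (hC : HasCodeType k₀ k₁ k₂ k₃ π C) (n : ℕ) :
    Nat.card {x : G // x ∈ C ∧ n • x = 0} = Nat.card {x : ZMod 2 // n • x = 0} ^ (k₀ + k₃) *
      (Nat.card {x : ZMod 8 // n • x = 0} ^ k₁ * Nat.card {x : ZMod 4 // n • x = 0} ^ k₂) := by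
  obtain ⟨e⟩ := hC.1
  rw [← card_nsmul_eq_zero_pi, ← card_nsmul_eq_zero_pi, ← card_nsmul_eq_zero_pi,
    ← card_nsmul_eq_zero_prod, ← card_nsmul_eq_zero_prod]
  have e₁ : {x : G // x ∈ C ∧ n • x = 0} ≃ {x : C // n • x = 0} :=
    { toFun := fun x => ⟨⟨x.1, x.2.1⟩, Subtype.ext x.2.2⟩
      invFun := fun x => ⟨x.1.1, x.1.2, congrArg Subtype.val x.2⟩
      left_inv := fun _ => rfl
      right_inv := fun _ => rfl }
  exact Nat.card_congr (e₁.trans (e.toEquiv.subtypeEquiv fun x => by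
    rw [AddEquiv.toEquiv_eq_coe, AddEquiv.coe_toEquiv, ← map_nsmul, map_eq_zero_iff e e.injective]))

theorem HasCodeType.card_kernel [Finite V] {π : G →+ V} {C : AddSubgroup G}
    (hC : HasCodeType k₀ k₁ k₂ k₃ π C) :
    Nat.card {x : G // x ∈ C ∧ 2 • x = 0 ∧ π x = 0} = 2 ^ (k₁ + k₂ + k₃) := by
  obtain ⟨W, hW, hWC⟩ := hC.2
  let ψ : ↥(C ⊓ nTorsion G 2) →+ V := π.comp (C ⊓ nTorsion G 2).subtype
  have hr : ψ.range = W.toAddSubgroup := by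
    apply SetLike.coe_injective
    rw [Submodule.coe_toAddSubgroup, hWC]
    ext v
    constructor
    · rintro ⟨x, rfl⟩
      exact ⟨x, ⟨x.2.1, (two_nsmul (x : G)).symm.trans x.2.2⟩, rfl⟩
    · rintro ⟨x, ⟨hx, h2⟩, rfl⟩
      exact ⟨⟨x, hx, (two_nsmul x).trans h2⟩, rfl⟩
  have hk : Nat.card ψ.ker = Nat.card {x : G // x ∈ C ∧ 2 • x = 0 ∧ π x = 0} :=
    Nat.card_congr
      { toFun := fun x => ⟨x.1.1, x.1.2.1, x.1.2.2, x.2⟩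
        invFun := fun x => ⟨⟨x.1, x.2.1, x.2.2.1⟩, x.2.2.2⟩
        left_inv := fun _ => rfl
        right_inv := fun _ => rfl }
  have hWcard : Nat.card W.toAddSubgroup = 2 ^ k₀ := by
    have : Nat.card W = 2 ^ k₀ := by
      rw [Module.natCard_eq_pow_finrank (K := ZMod 2), hW]
      simp
    exact this
  have hcard := ψ.natCard_eq_ker_mul_range
  have h2 : Nat.card ↥(C ⊓ nTorsion G 2) = Nat.card {x : G // x ∈ C ∧ 2 • x = 0} := rfl
  rw [hr, hk, hWcard, h2, hC.card_nsmul, card_two_nsmul_zmod_two, card_two_nsmul_zmod_four,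
    card_two_nsmul_zmod_eight] at hcard
  refine Nat.eq_of_mul_eq_mul_right (Nat.pow_pos (n := k₀) two_pos) (hcard.symm.trans ?_)
  ring

end CodeType

theorem MGN_denominator_ne_zero (k₀ k₁ k₂ k₃ : ℕ) :
    (∏ i ∈ range k₀, (2 ^ (k₀ + k₁ + k₂ + k₃) - 2 ^ (k₁ + k₂ + k₃ + i) : ℚ)) *
    (∏ i ∈ range k₁, ((8 ^ k₁ - 4 ^ k₁ * 2 ^ i : ℚ) * 2 ^ (k₀ + 2 * k₂ + k₃))) *
    (∏ i ∈ range k₂, ((4 ^ k₂ - 2 ^ (k₂ + i) : ℚ) * 2 ^ (k₀ + 2 * k₁ + k₃))) *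
    (∏ i ∈ range k₃, (2 ^ (k₁ + k₂ + k₃) - 2 ^ (k₁ + k₂ + i) : ℚ)) ≠ 0 := by
  have hlt : ∀ {m n : ℕ}, m < n → (2 ^ n - 2 ^ m : ℚ) ≠ 0 := fun h =>
    sub_ne_zero.2 (pow_lt_pow_right₀ one_lt_two h).ne'
  have h4 : ∀ n : ℕ, (4 : ℚ) ^ n = 2 ^ (2 * n) := fun n => by rw [pow_mul]; norm_num
  have h8 : ∀ n : ℕ, (8 : ℚ) ^ n = 2 ^ (3 * n) := fun n => by rw [pow_mul]; norm_num
  refine mul_ne_zero (mul_ne_zero (mul_ne_zero ?_ ?_) ?_) ?_ <;>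
    refine prod_ne_zero_iff.2 fun i hi => ?_ <;> rw [mem_range] at hi
  · exact hlt (by omega)
  · rw [h4, h8, ← pow_add]
    exact mul_ne_zero (hlt (by omega)) (by positivity)
  · rw [h4]
    exact mul_ne_zero (hlt (by omega)) (by positivity)
  · exact hlt (by omega)

theorem HasCodeType.card_isFrame {G V : Type*} [AddCommGroup G] [Finite G] [AddCommGroup V]
    [Finite V] [Module (ZMod 2) V] {k₀ k₁ k₂ k₃ : ℕ} {π : G →+ V} {C : AddSubgroup G}
    (hC : HasCodeType k₀ k₁ k₂ k₃ π C) :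
    (Nat.card {F : GenTuple G k₀ k₁ k₂ k₃ // IsFrame π C F} : ℚ) =
      (∏ i ∈ range k₀, (2 ^ (k₀ + k₁ + k₂ + k₃) - 2 ^ (k₁ + k₂ + k₃ + i) : ℚ)) *
      (∏ i ∈ range k₁, ((8 ^ k₁ - 4 ^ k₁ * 2 ^ i : ℚ) * 2 ^ (k₀ + 2 * k₂ + k₃))) *
      (∏ i ∈ range k₂, ((4 ^ k₂ - 2 ^ (k₂ + i) : ℚ) * 2 ^ (k₀ + 2 * k₁ + k₃))) *
      (∏ i ∈ range k₃, (2 ^ (k₁ + k₂ + k₃) - 2 ^ (k₁ + k₂ + i) : ℚ)) := by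
  have h4 : ∀ n : ℕ, (4 : ℚ) ^ n = 2 ^ (2 * n) := fun n => by rw [pow_mul]; norm_num
  have h8 : ∀ n : ℕ, (8 : ℚ) ^ n = 2 ^ (3 * n) := fun n => by rw [pow_mul]; norm_num
  rw [_root_.card_isFrame, hC.card_kernel, hC.card_nsmul, hC.card_nsmul, hC.card_nsmul,
    card_two_nsmul_zmod_two, card_two_nsmul_zmod_four, card_two_nsmul_zmod_eight,
    card_four_nsmul_zmod_two, card_four_nsmul_zmod_four, card_four_nsmul_zmod_eight,
    card_eight_nsmul_zmod_two, card_eight_nsmul_zmod_four, card_eight_nsmul_zmod_eight]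
  push_cast
  congr 1
  · congr 1
    · congr 1 <;> refine prod_congr rfl fun i _ => ?_
      · ring
      · rw [h4, h4, h8]
        ring
    · refine prod_congr rfl fun i _ => ?_
      rw [h4, h4]
      ring

theorem card_isFrame_top (α β k₀ k₁ k₂ k₃ : ℕ) :
    (Nat.card {F : GenTuple ((Fin α → ZMod 2) × (Fin β → ZMod 8)) k₀ k₁ k₂ k₃ //
        IsFrame (AddMonoidHom.fst _ _) ⊤ F} : ℚ) =
      (∏ i ∈ range k₀, ((2 ^ α - 2 ^ i : ℚ) * 2 ^ β)) *
      (∏ i ∈ range k₁, ((8 ^ β - 4 ^ β * 2 ^ i : ℚ) * 2 ^ α)) *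
      (∏ i ∈ range k₂, ((4 ^ β - 2 ^ (β + k₁ + i) : ℚ) * 2 ^ α)) *
      (∏ i ∈ range k₃, (2 ^ β - 2 ^ (k₁ + k₂ + i) : ℚ)) := by
  have htop : ∀ n : ℕ, Nat.card {x : (Fin α → ZMod 2) × (Fin β → ZMod 8) //
      x ∈ (⊤ : AddSubgroup ((Fin α → ZMod 2) × (Fin β → ZMod 8))) ∧ n • x = 0} =
      Nat.card {x : ZMod 2 // n • x = 0} ^ α * Nat.card {x : ZMod 8 // n • x = 0} ^ β := by
    intro n
    rw [← card_nsmul_eq_zero_pi, ← card_nsmul_eq_zero_pi, ← card_nsmul_eq_zero_prod]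
    exact Nat.card_congr (Equiv.subtypeEquivRight fun _ => and_iff_right trivial)
  have hker : Nat.card {x : (Fin α → ZMod 2) × (Fin β → ZMod 8) //
      x ∈ (⊤ : AddSubgroup ((Fin α → ZMod 2) × (Fin β → ZMod 8))) ∧ 2 • x = 0 ∧
        AddMonoidHom.fst (Fin α → ZMod 2) (Fin β → ZMod 8) x = 0} = 2 ^ β := by
    have h2 := card_nsmul_eq_zero_pi β (ZMod 8) 2
    rw [card_two_nsmul_zmod_eight] at h2
    rw [← h2]
    exact Nat.card_congr
      { toFun := fun x => ⟨x.1.2, congrArg Prod.snd x.2.2.1⟩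
        invFun := fun y => ⟨(0, y.1), trivial, Prod.ext (smul_zero (A := Fin α → ZMod 2) 2) y.2, rfl⟩
        left_inv := fun x => Subtype.ext (Prod.ext x.2.2.2.symm rfl)
        right_inv := fun _ => rfl }
  rw [card_isFrame, hker, htop, htop, htop,
    card_two_nsmul_zmod_two, card_two_nsmul_zmod_eight,
    card_four_nsmul_zmod_two, card_four_nsmul_zmod_eight,
    card_eight_nsmul_zmod_two, card_eight_nsmul_zmod_eight]
  push_cast
  congr 1
  congr 1
  · congr 1 <;> refine prod_congr rfl fun i _ => ?_ <;> ring
  · refine prod_congr rfl fun i _ => ?_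
    ring

/-- The number of additive subgroups of `(ZMod 2)^α × (ZMod 8)^β` that are abstractly
isomorphic to `(ZMod 2)^(k₀+k₃) × (ZMod 8)^(k₁) × (ZMod 4)^(k₂)` and whose 2-torsion
subgroup projects onto a `k₀`-dimensional `F₂`-subspace of the binary part equals
`N(α,β;k₀,k₁,k₂,k₃)`. -/
theorem count_Z2Z8_additive_codes (α β k₀ k₁ k₂ k₃ : ℕ) (h₀ : k₀ ≤ α)
    (h : k₁ + k₂ + k₃ ≤ β) :
    (Nat.card {C : AddSubgroup ((Fin α → ZMod 2) × (Fin β → ZMod 8)) //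
        Nonempty (C ≃+
          ((Fin (k₀ + k₃) → ZMod 2) × (Fin k₁ → ZMod 8) × (Fin k₂ → ZMod 4))) ∧
        ∃ W : Submodule (ZMod 2) (Fin α → ZMod 2),
          Module.finrank (ZMod 2) W = k₀ ∧
          (W : Set (Fin α → ZMod 2)) =
            Prod.fst '' {c : (Fin α → ZMod 2) × (Fin β → ZMod 8) | c ∈ C ∧ c + c = 0}} : ℚ)
      = MGN α β k₀ k₁ k₂ k₃ := by
  have hcard := card_hasCodeType_mul (k₀ := k₀) (k₁ := k₁) (k₂ := k₂) (k₃ := k₃)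
    (AddMonoidHom.fst (Fin α → ZMod 2) (Fin β → ZMod 8)) _ fun C hC => hC.card_isFrame
  rw [card_isFrame_top] at hcard
  exact (eq_div_iff (MGN_denominator_ne_zero k₀ k₁ k₂ k₃)).2 hcard
end

section
/- Let α, β, k₀, k₁, k₂ be nonnegative integers with k₀ ≤ α and k₁ + k₂ ≤ β. Then the number of additive subgroups C of (ZMod 2)^α × (ZMod 4)^β such that (i) C is isomorphic as an abelian group to (ZMod 2)^{k₀+k₂} × (ZMod 4)^{k₁}, and (ii) the image under the projection onto the first factor (ZMod 2)^α of the 2-torsion subgroup {c ∈ C : c + c = 0} is an F₂-subspace of dimension k₀, is equal to N(α,β;k₀,0,k₁,k₂). -/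
open Finset

lemma finrank_zmod_two_of_card {V : Type*} [AddCommGroup V] [Module (ZMod 2) V] [Finite V] {n : ℕ}
    (h : Nat.card V = 2 ^ n) : Module.finrank (ZMod 2) V = n := by
  have h' := Module.natCard_eq_pow_finrank (K := ZMod 2) (V := V)
  rw [h, Nat.card_zmod] at h'
  exact (Nat.pow_right_injective le_rfl h').symm

lemma card_map_mul_card_ker_inf {A B : Type*} [AddCommGroup A] [AddCommGroup B]
    (f : A →+ B) (C : AddSubgroup A) :
    Nat.card (C.map f) * Nat.card {a : A // a ∈ C ∧ f a = 0} = Nat.card C := by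
  have h := (f.comp C.subtype).ker.card_mul_index
  rw [AddSubgroup.index_ker, AddMonoidHom.range_comp, AddSubgroup.range_subtype, mul_comm] at h
  rw [← h]
  congr 1
  exact Nat.card_congr ((Equiv.subtypeSubtypeEquivSubtypeInter (· ∈ C) (fun a => f a = 0)).symm)

/-- Each independent tuple of a finite vector space lifts along a surjection in as many ways as
there are tuples in the kernel. -/
lemma card_linearIndependent_lifts_of_surjective {A B : Type*} [AddCommGroup A] [AddCommGroup B]
    [Module (ZMod 2) B] [Finite A] [Finite B] (f : A →+ B) (hf : Function.Surjective f)
    {n k : ℕ} (hn : Nat.card B = 2 ^ n) (hk : k ≤ n) :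
    Nat.card {s : Fin k → A // LinearIndependent (ZMod 2) (f ∘ s)} =
      (∏ i : Fin k, (2 ^ n - 2 ^ i.val)) * Nat.card f.ker ^ k := by
  let F (s : {s : Fin k → A // LinearIndependent (ZMod 2) (f ∘ s)}) :
      {t : Fin k → B // LinearIndependent (ZMod 2) t} := ⟨f ∘ s.1, s.2⟩
  have e (t : {t : Fin k → B // LinearIndependent (ZMod 2) t}) :
      {s // F s = t} ≃ (Fin k → f.ker) :=
    Equiv.trans (β := ∀ i, f ⁻¹' {t.1 i})
      { toFun := fun s i => ⟨s.1.1 i, congrFun (congrArg Subtype.val s.2) i⟩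
        invFun := fun s =>
          have h : (f ∘ fun i => (s i).1) = t.1 := funext fun i => (s i).2
          ⟨⟨fun i => (s i).1, h.symm ▸ t.2⟩, Subtype.ext h⟩
        left_inv := fun _ => rfl
        right_inv := fun _ => rfl }
      (Equiv.piCongrRight fun i => f.fiberEquivKerOfSurjective hf (t.1 i))
  have hfr := finrank_zmod_two_of_card hn
  rw [Nat.card_congr ((Equiv.sigmaFiberEquiv F).symm.trans
    ((Equiv.sigmaCongrRight e).trans (Equiv.sigmaEquivProd _ _))), Nat.card_prod,
    card_linearIndependent (by omega), Nat.card_fun, hfr]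
  simp

lemma card_linearIndependent_lifts {A B : Type*} [AddCommGroup A] [AddCommGroup B]
    [Module (ZMod 2) B] [Finite A] [Finite B] (f : A →+ B) (C : AddSubgroup A)
    {n m k : ℕ} (hn : Nat.card (C.map f) = 2 ^ n)
    (hm : Nat.card {a : A // a ∈ C ∧ f a = 0} = m) (hk : k ≤ n) :
    Nat.card {s : Fin k → A // (∀ i, s i ∈ C) ∧ LinearIndependent (ZMod 2) (f ∘ s)} =
      (∏ i : Fin k, (2 ^ n - 2 ^ i.val)) * m ^ k := by
  let S : Submodule (ZMod 2) B := AddSubgroup.toZModSubmodule 2 (C.map f)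
  let g : C →+ S :=
    AddMonoidHom.mk' (fun a => ⟨f a, AddSubgroup.mem_map_of_mem f a.2⟩) (fun a b => by ext; simp)
  have hg : Function.Surjective g := by
    rintro ⟨b, a, ha, rfl⟩
    exact ⟨⟨a, ha⟩, rfl⟩
  have key := card_linearIndependent_lifts_of_surjective g hg (n := n) hn hk
  have hker : Nat.card g.ker = m := by
    rw [← hm]
    refine Nat.card_congr (Equiv.trans ?_
      (Equiv.subtypeSubtypeEquivSubtypeInter (· ∈ C) (fun a => f a = 0)))
    exact Equiv.subtypeEquivRight fun a => by
      rw [AddMonoidHom.mem_ker]; exact Subtype.ext_iff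
  rw [hker] at key
  rw [← key]
  refine Nat.card_congr
    { toFun := fun s => ⟨fun i => ⟨s.1 i, s.2.1 i⟩, ?_⟩
      invFun := fun s => ⟨fun i => (s.1 i).1, fun i => (s.1 i).2, ?_⟩
      left_inv := fun s => rfl
      right_inv := fun s => rfl }
  · exact LinearIndependent.of_comp S.subtype s.2.2
  · exact s.2.map' S.subtype (Submodule.ker_subtype S)

/-- `ZMod 4` acts on `ZMod 2` through reduction. -/
abbrev zmodFourModuleZModTwo : Module (ZMod 4) (ZMod 2) :=
  Module.compHom _ (ZMod.castHom (show 2 ∣ 4 by norm_num) (ZMod 2))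

attribute [local instance] zmodFourModuleZModTwo

/-- The ambient group of `ℤ₂ℤ₄`-additive codes. -/
abbrev MixedSpace (α β : ℕ) : Type := (Fin α → ZMod 2) × (Fin β → ZMod 4)

/-- Multiplication by `2` as an embedding of `ZMod 2` in `ZMod 4`. -/
def doubleHom : ZMod 2 →+ ZMod 4 :=
  AddMonoidHom.mk' (fun a => 2 * (a.val : ZMod 4)) (by decide)

section

variable {α β : ℕ}

/-- Reduction modulo `2` of the quaternary part. -/
def redHom (α β : ℕ) : MixedSpace α β →ₗ[ZMod 4] (Fin β → ZMod 2) where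
  toFun g i := ZMod.castHom (show 2 ∣ 4 by norm_num) (ZMod 2) (g.2 i)
  map_add' g h := by ext i; simp
  map_smul' c g := by
    ext i
    simp only [Prod.smul_snd, Pi.smul_apply, smul_eq_mul, map_mul]
    rfl

/-- The embedding of pairs of binary words whose image is the `2`-torsion of the mixed space. -/
def torsionHom (α β : ℕ) :
    (Fin α → ZMod 2) × (Fin β → ZMod 2) →+ MixedSpace α β :=
  (AddMonoidHom.id _).prodMap (doubleHom.compLeft (Fin β))

lemma torsionHom_injective : Function.Injective (torsionHom α β) := by
  have hd : Function.Injective doubleHom := by decide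
  exact Function.injective_id.prodMap hd.comp_left

lemma torsionHom_red (g : MixedSpace α β) : torsionHom α β (0, redHom α β g) = g + g := by
  have h4 : ∀ a : ZMod 4, doubleHom (ZMod.castHom (show 2 ∣ 4 by norm_num) (ZMod 2) a) = a + a := by
    decide
  ext i
  · exact (CharTwo.add_self_eq_zero (g.1 i)).symm
  · exact h4 (g.2 i)

lemma red_torsionHom (p : (Fin α → ZMod 2) × (Fin β → ZMod 2)) :
    redHom α β (torsionHom α β p) = 0 := by
  have h : ∀ a : ZMod 2, ZMod.castHom (show 2 ∣ 4 by norm_num) (ZMod 2) (doubleHom a) = 0 := by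
    decide
  ext i
  exact h (p.2 i)

lemma add_self_eq_zero_iff_red (g : MixedSpace α β) : g + g = 0 ↔ redHom α β g = 0 := by
  rw [← torsionHom_red, map_eq_zero_iff _ torsionHom_injective]
  simp

lemma red_eq_zero_iff (g : MixedSpace α β) :
    redHom α β g = 0 ↔ ∃ p, torsionHom α β p = g := by
  constructor
  · intro hg
    have h : ∀ a : ZMod 4, ZMod.castHom (show 2 ∣ 4 by norm_num) (ZMod 2) a = 0 →
        ∃ b, doubleHom b = a := by decide
    choose b hb using fun i => h (g.2 i) (congrFun hg i)
    exact ⟨(g.1, b), Prod.ext rfl (funext hb)⟩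
  · rintro ⟨p, rfl⟩
    exact red_torsionHom p

lemma add_self_eq_zero_iff (g : MixedSpace α β) : g + g = 0 ↔ ∃ p, torsionHom α β p = g := by
  rw [add_self_eq_zero_iff_red, red_eq_zero_iff]

lemma redHom_surjective : Function.Surjective (redHom α β) := by
  have h : Function.Surjective (ZMod.castHom (show 2 ∣ 4 by norm_num) (ZMod 2)) :=
    ZMod.castHom_surjective _
  intro q
  choose b hb using fun i => h (q i)
  exact ⟨(0, b), funext hb⟩

lemma card_two_torsion (α β : ℕ) : Nat.card {g : MixedSpace α β // g + g = 0} = 2 ^ (α + β) := by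
  have e : {g : MixedSpace α β // g + g = 0} ≃ Set.range (torsionHom α β) :=
    Equiv.subtypeEquivRight fun g => add_self_eq_zero_iff g
  rw [Nat.card_congr e, Nat.card_range_of_injective torsionHom_injective]
  simp [pow_add]

/-- The `2`-torsion of a code, as pairs of binary words. -/
def torsionPart (C : AddSubgroup (MixedSpace α β)) :
    AddSubgroup ((Fin α → ZMod 2) × (Fin β → ZMod 2)) :=
  C.comap (torsionHom α β)

/-- The projection of the `2`-torsion of a code to the binary part. -/
def binaryPart (C : AddSubgroup (MixedSpace α β)) : AddSubgroup (Fin α → ZMod 2) :=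
  (torsionPart C).map (AddMonoidHom.fst _ _)

/-- The reduction modulo `2` of the quaternary part of a code. -/
def redPart (C : AddSubgroup (MixedSpace α β)) : AddSubgroup (Fin β → ZMod 2) :=
  C.map (redHom α β).toAddMonoidHom

/-- The words of a code with binary part zero and quaternary part divisible by two,
halved. -/
def kernelPart (C : AddSubgroup (MixedSpace α β)) : AddSubgroup (Fin β → ZMod 2) :=
  (torsionPart C).comap (AddMonoidHom.inr _ _)

lemma redPart_le_kernelPart (C : AddSubgroup (MixedSpace α β)) : redPart C ≤ kernelPart C := by
  rintro _ ⟨g, hg, rfl⟩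
  change torsionHom α β (0, redHom α β g) ∈ C
  rw [torsionHom_red]
  exact C.add_mem hg hg

lemma card_fst_kernel (C : AddSubgroup (MixedSpace α β)) :
    Nat.card {p // p ∈ torsionPart C ∧ AddMonoidHom.fst _ _ p = 0} = Nat.card (kernelPart C) :=
  Nat.card_congr
    { toFun := fun p => ⟨p.1.2, by
        have h : p.1 = (0, p.1.2) := Prod.ext p.2.2 rfl
        exact h ▸ p.2.1⟩
      invFun := fun q => ⟨(0, q.1), q.2, rfl⟩
      left_inv := fun p => Subtype.ext (Prod.ext p.2.2.symm rfl)
      right_inv := fun q => rfl }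

lemma card_red_kernel (C : AddSubgroup (MixedSpace α β)) :
    Nat.card {g // g ∈ C ∧ (redHom α β).toAddMonoidHom g = 0} = Nat.card (torsionPart C) := by
  refine (Nat.card_congr (Equiv.ofBijective
    (fun p : torsionPart C => (⟨torsionHom α β p.1, p.2, red_torsionHom p.1⟩ :
      {g // g ∈ C ∧ (redHom α β).toAddMonoidHom g = 0})) ⟨fun p q h => ?_, ?_⟩)).symm
  · exact Subtype.ext (torsionHom_injective (congrArg Subtype.val h))
  · rintro ⟨g, hg, h0⟩
    obtain ⟨p, rfl⟩ := (red_eq_zero_iff g).1 h0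
    exact ⟨⟨p, hg⟩, rfl⟩

lemma card_torsionPart (C : AddSubgroup (MixedSpace α β)) :
    Nat.card (torsionPart C) = Nat.card (binaryPart C) * Nat.card (kernelPart C) := by
  rw [← card_fst_kernel, binaryPart, card_map_mul_card_ker_inf]

lemma card_code (C : AddSubgroup (MixedSpace α β)) :
    Nat.card C = Nat.card (redPart C) * Nat.card (torsionPart C) := by
  rw [← card_red_kernel, redPart, card_map_mul_card_ker_inf]

/-- The sizes of the associated binary codes of a code of type `(α, β; a, b, u - b)`. -/
structure HasShape (C : AddSubgroup (MixedSpace α β)) (a b u : ℕ) : Prop where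
  card_binaryPart : Nat.card (binaryPart C) = 2 ^ a
  card_redPart : Nat.card (redPart C) = 2 ^ b
  card_kernelPart : Nat.card (kernelPart C) = 2 ^ u

lemma hasShape_top : HasShape (⊤ : AddSubgroup (MixedSpace α β)) α β β := by
  have h1 : binaryPart (⊤ : AddSubgroup (MixedSpace α β)) = ⊤ :=
    eq_top_iff.2 fun p _ => ⟨(p, 0), trivial, rfl⟩
  have h2 : redPart (⊤ : AddSubgroup (MixedSpace α β)) = ⊤ :=
    eq_top_iff.2 fun q _ => (redHom_surjective q).imp fun g hg => ⟨trivial, hg⟩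
  have h3 : kernelPart (⊤ : AddSubgroup (MixedSpace α β)) = ⊤ := rfl
  constructor <;> simp [h1, h2, h3]

/-- A family of generators in standard form: order-two words independent on the binary part,
order-four words independent modulo `2`, and doubled words independent modulo the doubles of the
order-four words. -/
def IsGeneratingFamily (k₀ k₁ k₂ : ℕ) (t : (Fin k₀ → (Fin α → ZMod 2) × (Fin β → ZMod 2)) ×
    (Fin k₁ → MixedSpace α β) × (Fin k₂ → (Fin β → ZMod 2))) : Prop :=
  LinearIndependent (ZMod 2) (AddMonoidHom.fst _ _ ∘ t.1) ∧
  LinearIndependent (ZMod 2) ((redHom α β).toAddMonoidHom ∘ t.2.1) ∧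
  LinearIndependent (ZMod 2)
    ((Submodule.span (ZMod 2) (Set.range ((redHom α β).toAddMonoidHom ∘ t.2.1))).mkQ.toAddMonoidHom
      ∘ t.2.2)

/-- All the words of the family belong to `C`. -/
def FamilyIn (C : AddSubgroup (MixedSpace α β)) {k₀ k₁ k₂ : ℕ}
    (t : (Fin k₀ → (Fin α → ZMod 2) × (Fin β → ZMod 2)) ×
      (Fin k₁ → MixedSpace α β) × (Fin k₂ → (Fin β → ZMod 2))) : Prop :=
  (∀ i, t.1 i ∈ torsionPart C) ∧ (∀ i, t.2.1 i ∈ C) ∧ (∀ i, t.2.2 i ∈ kernelPart C)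

lemma card_families {C : AddSubgroup (MixedSpace α β)} {a b u k₀ k₁ k₂ : ℕ}
    (hC : HasShape C a b u) (h₀ : k₀ ≤ a) (h₁ : k₁ ≤ b) (h₂ : k₁ + k₂ ≤ u) :
    Nat.card {t : (Fin k₀ → (Fin α → ZMod 2) × (Fin β → ZMod 2)) ×
        (Fin k₁ → MixedSpace α β) × (Fin k₂ → (Fin β → ZMod 2)) //
        FamilyIn C t ∧ IsGeneratingFamily k₀ k₁ k₂ t} =
      ((∏ i : Fin k₀, (2 ^ a - 2 ^ i.val)) * (2 ^ u) ^ k₀) *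
      (((∏ i : Fin k₁, (2 ^ b - 2 ^ i.val)) * (2 ^ (a + u)) ^ k₁) *
      ((∏ i : Fin k₂, (2 ^ (u - k₁) - 2 ^ i.val)) * (2 ^ k₁) ^ k₂)) := by
  have hx := card_linearIndependent_lifts
    (AddMonoidHom.fst (Fin α → ZMod 2) (Fin β → ZMod 2)) (torsionPart C)
    (n := a) (m := 2 ^ u) (k := k₀) hC.card_binaryPart
    ((card_fst_kernel C).trans hC.card_kernelPart) h₀
  have hT : Nat.card (torsionPart C) = 2 ^ (a + u) := by
    rw [card_torsionPart, hC.card_binaryPart, hC.card_kernelPart, pow_add]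
  have hy := card_linearIndependent_lifts (redHom α β).toAddMonoidHom C
    (n := b) (m := 2 ^ (a + u)) (k := k₁) hC.card_redPart ((card_red_kernel C).trans hT) h₁
  have hz (y : {s : Fin k₁ → MixedSpace α β // (∀ i, s i ∈ C) ∧
      LinearIndependent (ZMod 2) ((redHom α β).toAddMonoidHom ∘ s)}) :
      Nat.card {s : Fin k₂ → (Fin β → ZMod 2) // (∀ i, s i ∈ kernelPart C) ∧
        LinearIndependent (ZMod 2)
        ((Submodule.span (ZMod 2)
          (Set.range ((redHom α β).toAddMonoidHom ∘ y.1))).mkQ.toAddMonoidHom ∘ s)} =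
      (∏ i : Fin k₂, (2 ^ (u - k₁) - 2 ^ i.val)) * (2 ^ k₁) ^ k₂ := by
    set S := Submodule.span (ZMod 2) (Set.range ((redHom α β).toAddMonoidHom ∘ y.1)) with hS
    have hSU : S ≤ AddSubgroup.toZModSubmodule 2 (kernelPart C) := by
      rw [hS, Submodule.span_le]
      rintro _ ⟨i, rfl⟩
      exact redPart_le_kernelPart C ⟨y.1 i, y.2.1 i, rfl⟩
    have hker : Nat.card {q // q ∈ kernelPart C ∧ S.mkQ.toAddMonoidHom q = 0} = 2 ^ k₁ := by
      have e : {q // q ∈ kernelPart C ∧ S.mkQ.toAddMonoidHom q = 0} ≃ S :=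
        Equiv.subtypeEquivRight fun q => by
          change _ ∧ S.mkQ q = 0 ↔ _
          rw [Submodule.mkQ_apply, Submodule.Quotient.mk_eq_zero]
          exact ⟨fun h => h.2, fun h => ⟨hSU h, h⟩⟩
      rw [Nat.card_congr e, Module.natCard_eq_pow_finrank (K := ZMod 2), hS,
        finrank_span_eq_card y.2.2]
      simp
    refine card_linearIndependent_lifts _ _ ?_ hker (by omega)
    have h := card_map_mul_card_ker_inf S.mkQ.toAddMonoidHom (kernelPart C)
    rw [hker, hC.card_kernelPart] at h
    refine Nat.eq_of_mul_eq_mul_right (pow_pos two_pos k₁) (h.trans ?_)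
    rw [← pow_add]
    congr 1
    omega
  let Y := {s : Fin k₁ → MixedSpace α β // (∀ i, s i ∈ C) ∧
      LinearIndependent (ZMod 2) ((redHom α β).toAddMonoidHom ∘ s)}
  have : Fintype Y := Fintype.ofFinite Y
  have hY : Nat.card Y = _ := hy
  have e : {t : (Fin k₀ → (Fin α → ZMod 2) × (Fin β → ZMod 2)) ×
        (Fin k₁ → MixedSpace α β) × (Fin k₂ → (Fin β → ZMod 2)) //
        FamilyIn C t ∧ IsGeneratingFamily k₀ k₁ k₂ t} ≃
      {s : Fin k₀ → (Fin α → ZMod 2) × (Fin β → ZMod 2) // (∀ i, s i ∈ torsionPart C) ∧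
        LinearIndependent (ZMod 2) (AddMonoidHom.fst _ _ ∘ s)} ×
      Σ y : Y, {s : Fin k₂ → (Fin β → ZMod 2) // (∀ i, s i ∈ kernelPart C) ∧
        LinearIndependent (ZMod 2)
        ((Submodule.span (ZMod 2)
          (Set.range ((redHom α β).toAddMonoidHom ∘ y.1))).mkQ.toAddMonoidHom ∘ s)} :=
    { toFun := fun t => (⟨t.1.1, t.2.1.1, t.2.2.1⟩, ⟨⟨t.1.2.1, t.2.1.2.1, t.2.2.2.1⟩,
        ⟨t.1.2.2, t.2.1.2.2, t.2.2.2.2⟩⟩)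
      invFun := fun s => ⟨(s.1.1, s.2.1.1, s.2.2.1),
        ⟨s.1.2.1, s.2.1.2.1, s.2.2.2.1⟩, ⟨s.1.2.2, s.2.1.2.2, s.2.2.2.2⟩⟩
      left_inv := fun _ => rfl
      right_inv := fun _ => rfl }
  rw [Nat.card_congr e, Nat.card_prod, hx, Nat.card_sigma, Finset.sum_congr rfl fun y _ => hz y,
    Finset.sum_const, smul_eq_mul, Finset.card_univ, ← Nat.card_eq_fintype_card, hY]

/-- The words with given coefficients with respect to a family. -/
def combination {k₀ k₁ k₂ : ℕ} (t : (Fin k₀ → (Fin α → ZMod 2) × (Fin β → ZMod 2)) ×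
    (Fin k₁ → MixedSpace α β) × (Fin k₂ → (Fin β → ZMod 2))) :
    (Fin (k₀ + k₂) → ZMod 2) × (Fin k₁ → ZMod 4) →+ MixedSpace α β :=
  ((torsionHom α β).comp (Fintype.linearCombination (ZMod 2)
    (Fin.append t.1 (fun i => (0, t.2.2 i)))).toAddMonoidHom).coprod
    (Fintype.linearCombination (ZMod 4) t.2.1).toAddMonoidHom

variable {k₀ k₁ k₂ : ℕ} {t : (Fin k₀ → (Fin α → ZMod 2) × (Fin β → ZMod 2)) ×
    (Fin k₁ → MixedSpace α β) × (Fin k₂ → (Fin β → ZMod 2))}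

lemma combination_apply (v : (Fin (k₀ + k₂) → ZMod 2) × (Fin k₁ → ZMod 4)) :
    combination t v =
      torsionHom α β (∑ i, v.1 (Fin.castAdd k₂ i) • t.1 i +
        ∑ i, v.1 (Fin.natAdd k₀ i) • (0, t.2.2 i)) + ∑ i, v.2 i • t.2.1 i := by
  have h : ∑ i, v.1 i • Fin.append t.1 (fun i => ((0, t.2.2 i) :
      (Fin α → ZMod 2) × (Fin β → ZMod 2))) i =
      ∑ i, v.1 (Fin.castAdd k₂ i) • t.1 i + ∑ i, v.1 (Fin.natAdd k₀ i) • (0, t.2.2 i) := by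
    rw [Fin.sum_univ_add]
    simp only [Fin.append_left, Fin.append_right]
  rw [← h]
  rfl

lemma range_combination_le {C : AddSubgroup (MixedSpace α β)} (h : FamilyIn C t) :
    (combination t).range ≤ C := by
  rintro _ ⟨v, rfl⟩
  rw [combination_apply]
  refine C.add_mem ?_ ?_
  · change _ ∈ AddSubgroup.toZModSubmodule 2 (torsionPart C)
    exact add_mem (sum_mem fun i _ => Submodule.smul_mem _ _ (h.1 i))
      (sum_mem fun i _ => Submodule.smul_mem _ _ (h.2.2 i))
  · change _ ∈ AddSubgroup.toZModSubmodule 4 C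
    exact sum_mem fun i _ => Submodule.smul_mem _ _ (h.2.1 i)

lemma familyIn_range_combination (t : (Fin k₀ → (Fin α → ZMod 2) × (Fin β → ZMod 2)) ×
    (Fin k₁ → MixedSpace α β) × (Fin k₂ → (Fin β → ZMod 2))) :
    FamilyIn (combination t).range t := by
  refine ⟨fun i => ⟨(Fin.append (Pi.single i 1) 0, 0), ?_⟩, fun i => ⟨(0, Pi.single i 1), ?_⟩,
    fun i => ⟨(Fin.append 0 (Pi.single i 1), 0), ?_⟩⟩
  · simp [combination_apply, Pi.single_apply]
  · simp [combination_apply, Pi.single_apply]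
  · simp [combination_apply, Pi.single_apply]

lemma red_combination (v : (Fin (k₀ + k₂) → ZMod 2) × (Fin k₁ → ZMod 4)) :
    redHom α β (combination t v) =
      ∑ i, ZMod.castHom (show 2 ∣ 4 by norm_num) (ZMod 2) (v.2 i) • redHom α β (t.2.1 i) := by
  rw [combination_apply, map_add, red_torsionHom, zero_add, map_sum]
  simp only [map_smul]
  rfl

lemma doubleHom_smul (c : ZMod 2) (g : MixedSpace α β) :
    doubleHom c • g = torsionHom α β (0, c • redHom α β g) := by
  have h : c = 0 ∨ c = 1 := by revert c; decide
  rcases h with rfl | rfl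
  · simp [← Prod.zero_eq_mk]
  · rw [one_smul, torsionHom_red, show doubleHom 1 = 1 + 1 from rfl, add_smul, one_smul]

lemma exists_torsionHom_eq_combination (ht : IsGeneratingFamily k₀ k₁ k₂ t)
    {v : (Fin (k₀ + k₂) → ZMod 2) × (Fin k₁ → ZMod 4)}
    (hv : redHom α β (combination t v) = 0) :
    ∃ c : Fin k₁ → ZMod 2, (∀ i, v.2 i = doubleHom (c i)) ∧
      combination t v = torsionHom α β
        (∑ i, v.1 (Fin.castAdd k₂ i) • (t.1 i).1,
         ∑ i, v.1 (Fin.castAdd k₂ i) • (t.1 i).2 + ∑ i, v.1 (Fin.natAdd k₀ i) • t.2.2 i +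
          ∑ i, c i • redHom α β (t.2.1 i)) := by
  rw [red_combination] at hv
  have hc := Fintype.linearIndependent_iff.1 ht.2.1 _ hv
  have h : ∀ a : ZMod 4, ZMod.castHom (show 2 ∣ 4 by norm_num) (ZMod 2) a = 0 →
      ∃ b, a = doubleHom b := by decide
  choose c hc using fun i => h (v.2 i) (hc i)
  refine ⟨c, hc, ?_⟩
  rw [combination_apply]
  simp only [hc, doubleHom_smul]
  rw [← map_sum, ← map_add]
  congr 1
  ext : 1 <;> simp [Prod.fst_sum, Prod.snd_sum]

lemma combination_injective (ht : IsGeneratingFamily k₀ k₁ k₂ t) :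
    Function.Injective (combination t) := by
  rw [injective_iff_map_eq_zero]
  intro v hv
  obtain ⟨c, hc, h⟩ := exists_torsionHom_eq_combination ht (v := v) (by rw [hv, map_zero])
  rw [hv, eq_comm, map_eq_zero_iff _ torsionHom_injective, Prod.mk_eq_zero] at h
  have ha := Fintype.linearIndependent_iff.1 ht.1 _ h.1
  have h2 := h.2
  simp only [ha, zero_smul, Finset.sum_const_zero, zero_add] at h2
  set S := Submodule.span (ZMod 2) (Set.range ((redHom α β).toAddMonoidHom ∘ t.2.1)) with hS
  have hb := Fintype.linearIndependent_iff.1 ht.2.2 (fun i => v.1 (Fin.natAdd k₀ i)) (by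
    change ∑ i, v.1 (Fin.natAdd k₀ i) • S.mkQ (t.2.2 i) = 0
    simp only [← map_smul]
    rw [← map_sum, Submodule.mkQ_apply, Submodule.Quotient.mk_eq_zero,
      eq_neg_of_add_eq_zero_left h2]
    exact neg_mem (sum_mem fun i _ => Submodule.smul_mem _ _ (Submodule.subset_span ⟨i, rfl⟩)))
  simp only [hb, zero_smul, Finset.sum_const_zero, zero_add] at h2
  have hc0 := Fintype.linearIndependent_iff.1 ht.2.1 c h2
  ext i
  · refine Fin.addCases (fun i => ?_) (fun i => ?_) i
    · exact ha i
    · exact hb i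
  · simp [hc, hc0]

lemma binaryPart_range_combination (ht : IsGeneratingFamily k₀ k₁ k₂ t) :
    AddSubgroup.toZModSubmodule 2 (binaryPart (combination t).range) =
      Submodule.span (ZMod 2)
        (Set.range (AddMonoidHom.fst (Fin α → ZMod 2) (Fin β → ZMod 2) ∘ t.1)) := by
  apply le_antisymm
  · rintro _ ⟨⟨p, q⟩, ⟨v, hv⟩, rfl⟩
    obtain ⟨c, -, h⟩ := exists_torsionHom_eq_combination ht (v := v)
      (by rw [hv, red_torsionHom])
    have hp := congrArg Prod.fst (torsionHom_injective (hv.symm.trans h))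
    dsimp only at hp
    change p ∈ Submodule.span (ZMod 2)
      (Set.range (AddMonoidHom.fst (Fin α → ZMod 2) (Fin β → ZMod 2) ∘ t.1))
    rw [hp]
    refine Submodule.sum_mem _ fun i _ => ?_
    exact Submodule.smul_mem _ _ (Submodule.subset_span ⟨i, rfl⟩)
  · rw [Submodule.span_le]
    rintro _ ⟨i, rfl⟩
    exact ⟨t.1 i, (familyIn_range_combination t).1 i, rfl⟩

end

/-- The two conditions defining a code of type `(α, β; k₀, k₁, k₂)`. -/
abbrev IsCode {α β : ℕ} (k₀ k₁ k₂ : ℕ) (C : AddSubgroup (MixedSpace α β)) : Prop :=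
  Nonempty (C ≃+ ((Fin (k₀ + k₂) → ZMod 2) × (Fin k₁ → ZMod 4))) ∧
    ∃ W : Submodule (ZMod 2) (Fin α → ZMod 2),
      Module.finrank (ZMod 2) W = k₀ ∧
      (W : Set (Fin α → ZMod 2)) =
        Prod.fst '' {c : (Fin α → ZMod 2) × (Fin β → ZMod 4) | c ∈ C ∧ c + c = 0}

section

variable {α β k₀ k₁ k₂ : ℕ}

lemma coe_binaryPart (C : AddSubgroup (MixedSpace α β)) :
    (binaryPart C : Set (Fin α → ZMod 2)) = Prod.fst '' {c | c ∈ C ∧ c + c = 0} := by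
  ext p
  constructor
  · rintro ⟨q, hq, rfl⟩
    exact ⟨torsionHom α β q, ⟨hq, (add_self_eq_zero_iff _).2 ⟨q, rfl⟩⟩, rfl⟩
  · rintro ⟨c, ⟨hc, h0⟩, rfl⟩
    obtain ⟨q, rfl⟩ := (add_self_eq_zero_iff c).1 h0
    exact ⟨q, hc, rfl⟩

lemma IsCode.hasShape {C : AddSubgroup (MixedSpace α β)} (h : IsCode k₀ k₁ k₂ C) :
    HasShape C k₀ k₁ (k₁ + k₂) := by
  obtain ⟨⟨e⟩, W, hW, hWC⟩ := h
  have hB : Nat.card (binaryPart C) = 2 ^ k₀ := by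
    have : (W : Set (Fin α → ZMod 2)) = binaryPart C := by rw [hWC, coe_binaryPart]
    rw [← SetLike.coe_sort_coe, ← this, SetLike.coe_sort_coe,
      Module.natCard_eq_pow_finrank (K := ZMod 2), hW, Nat.card_zmod]
  have hT : Nat.card (torsionPart C) = 2 ^ (k₀ + k₂ + k₁) := by
    rw [← card_two_torsion, ← card_red_kernel]
    refine Nat.card_congr (((Equiv.subtypeSubtypeEquivSubtypeInter (· ∈ C)
      (fun g => (redHom α β).toAddMonoidHom g = 0)).symm).trans
      (e.toEquiv.subtypeEquiv fun g => ?_))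
    change redHom α β g = 0 ↔ e g + e g = 0
    rw [← map_add, map_eq_zero_iff _ e.injective, ← add_self_eq_zero_iff_red, Subtype.ext_iff]
    rfl
  have hC : Nat.card C = 2 ^ (k₀ + k₂ + 2 * k₁) := by
    rw [Nat.card_congr e.toEquiv]
    simp [pow_add, pow_mul]
  refine ⟨hB, ?_, ?_⟩
  · have h := card_code C
    rw [hC, hT] at h
    refine Nat.eq_of_mul_eq_mul_right (pow_pos two_pos (k₀ + k₂ + k₁)) (h.symm.trans ?_)
    rw [← pow_add]
    congr 1
    ring
  · have h := card_torsionPart C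
    rw [hB, hT] at h
    refine Nat.eq_of_mul_eq_mul_left (pow_pos two_pos k₀) (h.symm.trans ?_)
    rw [← pow_add]
    congr 1
    ring

lemma IsGeneratingFamily.isCode {t : (Fin k₀ → (Fin α → ZMod 2) × (Fin β → ZMod 2)) ×
    (Fin k₁ → MixedSpace α β) × (Fin k₂ → (Fin β → ZMod 2))}
    (ht : IsGeneratingFamily k₀ k₁ k₂ t) : IsCode k₀ k₁ k₂ (combination t).range := by
  refine ⟨⟨((combination t).ofInjective (combination_injective ht)).symm⟩,
    AddSubgroup.toZModSubmodule 2 (binaryPart (combination t).range), ?_, coe_binaryPart _⟩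
  rw [binaryPart_range_combination ht, finrank_span_eq_card ht.1, Fintype.card_fin]

lemma IsGeneratingFamily.range_eq_iff {t : (Fin k₀ → (Fin α → ZMod 2) × (Fin β → ZMod 2)) ×
    (Fin k₁ → MixedSpace α β) × (Fin k₂ → (Fin β → ZMod 2))}
    (ht : IsGeneratingFamily k₀ k₁ k₂ t) {C : AddSubgroup (MixedSpace α β)}
    (hC : IsCode k₀ k₁ k₂ C) : (combination t).range = C ↔ FamilyIn C t := by
  constructor
  · rintro rfl
    exact familyIn_range_combination t
  · intro h
    obtain ⟨⟨e⟩, -⟩ := hC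
    refine AddSubgroup.eq_of_le_of_card_ge (range_combination_le h) ?_
    rw [Nat.card_congr e.toEquiv,
      Nat.card_congr ((combination t).ofInjective (combination_injective ht)).symm.toEquiv]

/-- Counting generating families of the whole space by the code that they generate. -/
lemma card_codes_mul (h₀ : k₀ ≤ α) (h : k₁ + k₂ ≤ β) :
    Nat.card {C : AddSubgroup (MixedSpace α β) // IsCode k₀ k₁ k₂ C} *
      (((∏ i : Fin k₀, (2 ^ k₀ - 2 ^ i.val)) * (2 ^ (k₁ + k₂)) ^ k₀) *
      (((∏ i : Fin k₁, (2 ^ k₁ - 2 ^ i.val)) * (2 ^ (k₀ + (k₁ + k₂))) ^ k₁) *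
      ((∏ i : Fin k₂, (2 ^ (k₁ + k₂ - k₁) - 2 ^ i.val)) * (2 ^ k₁) ^ k₂))) =
      ((∏ i : Fin k₀, (2 ^ α - 2 ^ i.val)) * (2 ^ β) ^ k₀) *
      (((∏ i : Fin k₁, (2 ^ β - 2 ^ i.val)) * (2 ^ (α + β)) ^ k₁) *
      ((∏ i : Fin k₂, (2 ^ (β - k₁) - 2 ^ i.val)) * (2 ^ k₁) ^ k₂)) := by
  rw [← card_families hasShape_top h₀ (by omega) h]
  have : Fintype {C : AddSubgroup (MixedSpace α β) // IsCode k₀ k₁ k₂ C} := Fintype.ofFinite _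
  let F (t : {t : (Fin k₀ → (Fin α → ZMod 2) × (Fin β → ZMod 2)) ×
      (Fin k₁ → MixedSpace α β) × (Fin k₂ → (Fin β → ZMod 2)) // FamilyIn ⊤ t ∧
        IsGeneratingFamily k₀ k₁ k₂ t}) :
      {C : AddSubgroup (MixedSpace α β) // IsCode k₀ k₁ k₂ C} :=
    ⟨(combination t.1).range, t.2.2.isCode⟩
  have e (C : {C : AddSubgroup (MixedSpace α β) // IsCode k₀ k₁ k₂ C}) :
      {t // F t = C} ≃ {t : (Fin k₀ → (Fin α → ZMod 2) × (Fin β → ZMod 2)) ×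
        (Fin k₁ → MixedSpace α β) × (Fin k₂ → (Fin β → ZMod 2)) //
        FamilyIn C.1 t ∧ IsGeneratingFamily k₀ k₁ k₂ t} :=
    { toFun := fun t => ⟨t.1.1, (t.1.2.2.range_eq_iff C.2).1 (congrArg Subtype.val t.2), t.1.2.2⟩
      invFun := fun t => ⟨⟨t.1, ⟨fun _ => trivial, fun _ => trivial, fun _ => trivial⟩, t.2.2⟩,
        Subtype.ext ((t.2.2.range_eq_iff C.2).2 t.2.1)⟩
      left_inv := fun _ => rfl
      right_inv := fun _ => rfl }
  have (C : {C : AddSubgroup (MixedSpace α β) // IsCode k₀ k₁ k₂ C}) :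
      Finite {t : (Fin k₀ → (Fin α → ZMod 2) × (Fin β → ZMod 2)) ×
        (Fin k₁ → MixedSpace α β) × (Fin k₂ → (Fin β → ZMod 2)) //
        FamilyIn C.1 t ∧ IsGeneratingFamily k₀ k₁ k₂ t} := inferInstance
  rw [Nat.card_congr ((Equiv.sigmaFiberEquiv F).symm.trans (Equiv.sigmaCongrRight e)),
    Nat.card_sigma,
    Finset.sum_congr rfl fun C _ => card_families C.2.hasShape le_rfl le_rfl le_rfl,
    Finset.sum_const, smul_eq_mul, Finset.card_univ, ← Nat.card_eq_fintype_card]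

end

lemma cast_prod_two_pow_sub {k n : ℕ} (h : k ≤ n) :
    ((∏ i : Fin k, (2 ^ n - 2 ^ i.val) : ℕ) : ℚ) = ∏ i ∈ range k, ((2 : ℚ) ^ n - 2 ^ i) := by
  rw [Fin.prod_univ_eq_prod_range (fun i => 2 ^ n - 2 ^ i) k, Nat.cast_prod]
  refine Finset.prod_congr rfl fun i hi => ?_
  rw [Nat.cast_sub (Nat.pow_le_pow_right two_pos ((Finset.mem_range.1 hi).le.trans h))]
  push_cast
  rfl

lemma card_codes_factors_cast {a b u k₀ k₁ k₂ : ℕ} (h₀ : k₀ ≤ a) (h₁ : k₁ ≤ b)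
    (h₂ : k₁ + k₂ ≤ u) :
    ((((∏ i : Fin k₀, (2 ^ a - 2 ^ i.val)) * (2 ^ u) ^ k₀) *
      (((∏ i : Fin k₁, (2 ^ b - 2 ^ i.val)) * (2 ^ (a + u)) ^ k₁) *
      ((∏ i : Fin k₂, (2 ^ (u - k₁) - 2 ^ i.val)) * (2 ^ k₁) ^ k₂)) : ℕ) : ℚ) =
      (∏ i ∈ range k₀, ((2 ^ a - 2 ^ i : ℚ) * 2 ^ u)) *
      (∏ i ∈ range k₁, ((2 ^ b - 2 ^ i : ℚ) * 2 ^ (a + u))) *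
      ∏ i ∈ range k₂, (2 ^ u - 2 ^ (k₁ + i) : ℚ) := by
  have hu (i : ℕ) : (2 ^ u - 2 ^ (k₁ + i) : ℚ) = (2 ^ (u - k₁) - 2 ^ i) * 2 ^ k₁ := by
    rw [sub_mul, ← pow_add, ← pow_add, Nat.sub_add_cancel (by omega), add_comm i]
  simp only [hu, Finset.prod_mul_distrib, Finset.prod_const, Finset.card_range]
  rw [Nat.cast_mul, Nat.cast_mul, Nat.cast_mul, Nat.cast_mul, Nat.cast_mul,
    cast_prod_two_pow_sub h₀, cast_prod_two_pow_sub h₁, cast_prod_two_pow_sub (by omega)]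
  push_cast
  ring

lemma two_pow_sub_two_pow_ne_zero {i n : ℕ} (h : i < n) : (2 : ℚ) ^ n - 2 ^ i ≠ 0 :=
  sub_ne_zero.2 (pow_lt_pow_right₀ one_lt_two h).ne'

lemma MGN_zero_eq (α β k₀ k₁ k₂ : ℕ) :
    MGN α β k₀ 0 k₁ k₂ =
      ((∏ i ∈ range k₀, ((2 ^ α - 2 ^ i : ℚ) * 2 ^ β)) *
      (∏ i ∈ range k₁, ((2 ^ β - 2 ^ i : ℚ) * 2 ^ (α + β))) *
      ∏ i ∈ range k₂, (2 ^ β - 2 ^ (k₁ + i) : ℚ)) /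
      ((∏ i ∈ range k₀, ((2 ^ k₀ - 2 ^ i : ℚ) * 2 ^ (k₁ + k₂))) *
      (∏ i ∈ range k₁, ((2 ^ k₁ - 2 ^ i : ℚ) * 2 ^ (k₀ + (k₁ + k₂)))) *
      ∏ i ∈ range k₂, (2 ^ (k₁ + k₂) - 2 ^ (k₁ + i) : ℚ)) := by
  have h4 (n : ℕ) : (4 : ℚ) ^ n = 2 ^ n * 2 ^ n := by
    rw [← mul_pow]
    norm_num
  simp only [MGN, Finset.range_zero, Finset.prod_empty, mul_one, mul_zero, add_zero, zero_add, h4]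
  congr 1
  · congr 2
    exact Finset.prod_congr rfl fun i _ => by ring
  · congr 1
    congr 1
    · exact Finset.prod_congr rfl fun i _ => by ring
    · exact Finset.prod_congr rfl fun i _ => by ring

/-- The number of additive subgroups of `(ZMod 2)^α × (ZMod 4)^β` that are abstractly
isomorphic to `(ZMod 2)^(k₀+k₂) × (ZMod 4)^(k₁)` and whose 2-torsion subgroup projects
onto a `k₀`-dimensional `F₂`-subspace of the binary part equals `N(α,β;k₀,0,k₁,k₂)`. -/
theorem count_Z2Z4_additive_codes (α β k₀ k₁ k₂ : ℕ) (h₀ : k₀ ≤ α) (h : k₁ + k₂ ≤ β) :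
    (Nat.card {C : AddSubgroup ((Fin α → ZMod 2) × (Fin β → ZMod 4)) //
        Nonempty (C ≃+ ((Fin (k₀ + k₂) → ZMod 2) × (Fin k₁ → ZMod 4))) ∧
        ∃ W : Submodule (ZMod 2) (Fin α → ZMod 2),
          Module.finrank (ZMod 2) W = k₀ ∧
          (W : Set (Fin α → ZMod 2)) =
            Prod.fst '' {c : (Fin α → ZMod 2) × (Fin β → ZMod 4) | c ∈ C ∧ c + c = 0}} : ℚ)
      = MGN α β k₀ 0 k₁ k₂ := by
  rw [MGN_zero_eq, ← card_codes_factors_cast h₀ (by omega) h,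
    ← card_codes_factors_cast le_rfl le_rfl le_rfl, ← card_codes_mul h₀ h, Nat.cast_mul,
    mul_div_cancel_right₀]
  rw [card_codes_factors_cast le_rfl le_rfl le_rfl]
  refine mul_ne_zero (mul_ne_zero ?_ ?_) ?_ <;>
    refine Finset.prod_ne_zero_iff.2 fun i hi => ?_ <;> rw [Finset.mem_range] at hi
  · exact mul_ne_zero (two_pow_sub_two_pow_ne_zero hi) (by positivity)
  · exact mul_ne_zero (two_pow_sub_two_pow_ne_zero hi) (by positivity)
  · exact two_pow_sub_two_pow_ne_zero (by omega)
end
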